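/- Let F be an analytic self-mapping of the unit disc 𝔻. Assume that the measure |F'(z)|²(1 − |z|²)/(1 − |F(z)|²)² dA(z) is a vanishing Carleson measure on 𝔻. Then the boundary function ξ ↦ log(1 − |F(ξ)|²) on ∂𝔻 belongs to VMO, and consequently for every 0 < s < ∞ one has sup_{0<r<1} ∫_{∂𝔻} (1 − |F(rξ)|)^{−s} dm(ξ) < ∞. -/

import Mathlib

open MeasureTheory Filter Set Topology

noncomputable section

/-- The open unit disc in `ℂ`. -/
def unitDisc : Set ℂ := {z : ℂ | ‖z‖ < 1}

/-- The point `e^{iθ}` on the unit circle. -/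
def circlePt (θ : ℝ) : ℂ := Complex.exp ((θ : ℂ) * Complex.I)

/-- The Carleson square based on the arc centered at `e^{iθ₀}` of normalized length `t`. -/
def carlesonSquare (θ₀ t : ℝ) : Set ℂ :=
  {z : ℂ | z ∈ unitDisc ∧ 1 - t ≤ ‖z‖ ∧
    ∃ θ : ℝ, |θ - θ₀| ≤ Real.pi * t ∧ z = (‖z‖ : ℂ) * circlePt θ}

/-- `μ` is a Carleson measure. -/
def IsCarleson (μ : Measure ℂ) : Prop :=
  ∃ C : ℝ, 0 < C ∧ ∀ θ₀ t : ℝ, 0 < t → t ≤ 1 →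
    μ (carlesonSquare θ₀ t) ≤ ENNReal.ofReal (C * t)

/-- `μ` is a vanishing Carleson measure. -/
def IsVanishingCarleson (μ : Measure ℂ) : Prop :=
  IsCarleson μ ∧ ∀ ε : ℝ, 0 < ε → ∃ δ : ℝ, 0 < δ ∧ ∀ θ₀ t : ℝ, 0 < t → t < δ →
    μ (carlesonSquare θ₀ t) ≤ ENNReal.ofReal (ε * t)

/-- The measure `|E| μ`, i.e. `d(|E|μ)(z) = |E(z)| dμ(z)`. -/
def absDensity (E : ℂ → ℂ) (μ : Measure ℂ) : Measure ℂ :=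
  μ.withDensity (fun z => ENNReal.ofReal ‖E z‖)

/-- Average of a boundary function (in the angle variable) over the arc
centered at `e^{iθ₀}` of normalized length `t`; `dm = dθ/(2π)`. -/
def arcAvg (f : ℝ → ℂ) (θ₀ t : ℝ) : ℂ :=
  ((2 * Real.pi * t)⁻¹ : ℝ) •
    ∫ θ in Set.Ioo (θ₀ - Real.pi * t) (θ₀ + Real.pi * t), f θ

/-- Mean oscillation of a boundary function over the arc centered at `e^{iθ₀}`
of normalized length `t`. -/
def meanOsc (f : ℝ → ℂ) (θ₀ t : ℝ) : ℝ :=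
  (2 * Real.pi * t)⁻¹ *
    ∫ θ in Set.Ioo (θ₀ - Real.pi * t) (θ₀ + Real.pi * t), ‖f θ - arcAvg f θ₀ t‖

/-- A (2π-periodic, integrable) boundary function has bounded mean oscillation. -/
def IsBMO (f : ℝ → ℂ) : Prop :=
  (∀ θ : ℝ, f (θ + 2 * Real.pi) = f θ) ∧
  IntegrableOn f (Set.Ioc 0 (2 * Real.pi)) ∧
  ∃ C : ℝ, ∀ θ₀ t : ℝ, 0 < t → t ≤ 1 → meanOsc f θ₀ t ≤ C

/-- A boundary function has vanishing mean oscillation. -/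
def IsVMO (f : ℝ → ℂ) : Prop :=
  IsBMO f ∧ ∀ ε : ℝ, 0 < ε → ∃ δ : ℝ, 0 < δ ∧
    ∀ θ₀ t : ℝ, 0 < t → t < δ → meanOsc f θ₀ t ≤ ε

/-- The BMO seminorm of a boundary function. -/
def bmoSeminorm (f : ℝ → ℂ) : ℝ :=
  sSup {c : ℝ | ∃ θ₀ t : ℝ, 0 < t ∧ t ≤ 1 ∧ c = meanOsc f θ₀ t}

/-- `Fb` is the (a.e.) radial boundary function of `F`. -/
def HasRadialLimits (F : ℂ → ℂ) (Fb : ℝ → ℂ) : Prop :=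
  ∀ᵐ θ ∂(volume.restrict (Set.Ioc 0 (2 * Real.pi))),
    Tendsto (fun r : ℝ => F ((r : ℂ) * circlePt θ))
      (nhdsWithin 1 (Set.Iio 1)) (nhds (Fb θ))

/-- `F` is a bounded analytic function on the unit disc. -/
def MemHinf (F : ℂ → ℂ) : Prop :=
  DifferentiableOn ℂ F unitDisc ∧ ∃ M : ℝ, ∀ z ∈ unitDisc, ‖F z‖ ≤ M

/-- `F` belongs to `QA` with boundary function `Fb`: it is a bounded analytic
function on the disc whose radial boundary values are in VMO. -/
def MemQA (F : ℂ → ℂ) (Fb : ℝ → ℂ) : Prop :=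
  MemHinf F ∧ HasRadialLimits F Fb ∧ IsVMO Fb

/-- `E` is an outer function. -/
def IsOuter (E : ℂ → ℂ) : Prop :=
  DifferentiableOn ℂ E unitDisc ∧
  ∃ h : ℝ → ℝ, IntegrableOn h (Set.Ioc 0 (2 * Real.pi)) ∧ ∀ z ∈ unitDisc,
    E z = Complex.exp (((2 * Real.pi)⁻¹ : ℝ) • ∫ θ in Set.Ioc 0 (2 * Real.pi),
      ((circlePt θ + z) / (circlePt θ - z)) * (h θ : ℂ))

/-- The integral means appearing in the definition of the Hardy space `ℍ^p`. -/
def hardyIntegral (p : ℝ) (F : ℂ → ℂ) (r : ℝ) : ℝ :=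
  ∫ θ in Set.Ioc 0 (2 * Real.pi), ‖F ((r : ℂ) * circlePt θ)‖ ^ p

/-- `F` belongs to the Hardy space `ℍ^p`, `0 < p < ∞`. -/
def MemHardy (p : ℝ) (F : ℂ → ℂ) : Prop :=
  DifferentiableOn ℂ F unitDisc ∧
  ∃ M : ℝ, ∀ r : ℝ, 0 < r → r < 1 → hardyIntegral p F r ≤ M

/-- `F` belongs to `BMOA` with boundary function `Fb`. -/
def MemBMOA (F : ℂ → ℂ) (Fb : ℝ → ℂ) : Prop :=
  MemHardy 2 F ∧ HasRadialLimits F Fb ∧ IsBMO Fb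

/-- `F` belongs to `VMOA` with boundary function `Fb`. -/
def MemVMOA (F : ℂ → ℂ) (Fb : ℝ → ℂ) : Prop :=
  MemHardy 2 F ∧ HasRadialLimits F Fb ∧ IsVMO Fb

/-- The generalized Volterra operator `T_G(F)(z) = ∫₀^z F(w) G'(w) dw`. -/
def volterra (G F : ℂ → ℂ) (z : ℂ) : ℂ :=
  ∫ t in (0:ℝ)..1, z * F ((t : ℂ) * z) * deriv G ((t : ℂ) * z)


/-- The hyperbolic density `|F'(z)|²(1-|z|²)/(1-|F(z)|²)²`. -/
def hypDensity (F : ℂ → ℂ) (z : ℂ) : ENNReal :=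
  ENNReal.ofReal (‖deriv F z‖ ^ 2 * (1 - ‖z‖ ^ 2) / (1 - ‖F z‖ ^ 2) ^ 2)

section Parseval

open Complex Metric
open scoped Real ENNReal

lemma unitDisc_eq_ball : unitDisc = ball (0 : ℂ) 1 := by
  ext z; simp [unitDisc]

lemma circleMap_zero_eq (r θ : ℝ) : circleMap 0 r θ = (r : ℂ) * circlePt θ := by
  simp [circleMap, circlePt]

lemma fourierCoeffOn_circleMap_nat {f : ℂ → ℂ} {ρ r : ℝ} (hf : DifferentiableOn ℂ f (ball 0 ρ))
    (hr : 0 < r) (hrρ : r < ρ) (n : ℕ) :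
    fourierCoeffOn (show (0 : ℝ) < 2 * π by positivity) (fun θ => f (circleMap 0 r θ)) (n : ℤ) =
      (r : ℂ) ^ n * (iteratedDeriv n f 0 / n.factorial) := by
  have h := (hf.mono (closedBall_subset_ball hrρ)).circleIntegral_one_div_sub_center_pow_smul hr n
  rw [circleIntegral] at h
  have hr0 : (r : ℂ) ≠ 0 := by exact_mod_cast hr.ne'
  have hpi : (2 * π * I : ℂ) ≠ 0 := two_pi_I_ne_zero
  have key : ∀ θ : ℝ, deriv (circleMap 0 r) θ • (1 / (circleMap 0 r θ - 0) ^ (n + 1)) •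
      f (circleMap 0 r θ) = (I / (r : ℂ) ^ n) *
        (fourier (-(n : ℤ)) (θ : AddCircle (2 * π - 0)) • f (circleMap 0 r θ)) := by
    intro θ
    rw [fourier_coe_apply, deriv_circleMap]
    simp only [circleMap, zero_add, sub_zero, smul_eq_mul]
    have he : cexp (2 * π * I * ((-(n : ℤ) : ℤ) : ℂ) * θ / ((2 * π : ℝ) : ℂ)) =
        (cexp (θ * I) ^ n)⁻¹ := by
      rw [← Complex.exp_nat_mul, ← Complex.exp_neg]
      congr 1
      have : (π : ℂ) ≠ 0 := by exact_mod_cast Real.pi_ne_zero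
      push_cast
      field_simp
    rw [he]
    have : cexp (θ * I) ≠ 0 := Complex.exp_ne_zero _
    rw [mul_pow]
    field_simp
    ring
  simp_rw [key] at h
  rw [intervalIntegral.integral_const_mul] at h
  rw [fourierCoeffOn_eq_integral]
  set J := ∫ (x : ℝ) in (0 : ℝ)..2 * π, fourier (-(n : ℤ)) (x : AddCircle (2 * π - 0)) •
    f (circleMap 0 r x) with hJ
  have hI : I ≠ 0 := I_ne_zero
  have hpi' : (π : ℂ) ≠ 0 := by exact_mod_cast Real.pi_ne_zero
  have hfac : ((n.factorial : ℕ) : ℂ) ≠ 0 := by exact_mod_cast n.factorial_ne_zero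
  rw [smul_eq_mul] at h
  rw [Complex.real_smul]
  push_cast
  field_simp at h ⊢
  rw [sub_zero, mul_comm]
  linear_combination h

lemma fourierCoeffOn_circleMap_neg {f : ℂ → ℂ} {ρ r : ℝ} (hf : DifferentiableOn ℂ f (ball 0 ρ))
    (hr : 0 < r) (hrρ : r < ρ) (n : ℕ) :
    fourierCoeffOn (show (0 : ℝ) < 2 * π by positivity) (fun θ => f (circleMap 0 r θ))
      (-((n : ℤ) + 1)) = 0 := by
  have hr0 : (r : ℂ) ≠ 0 := by exact_mod_cast hr.ne'
  have h : (∮ z in C(0, r), z ^ n * f z) = 0 := by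
    apply circleIntegral_eq_zero_of_differentiable_on_off_countable hr.le countable_empty
    · have := (hf.mono (closedBall_subset_ball hrρ)).continuousOn
      fun_prop
    · intro z hz
      have : DifferentiableAt ℂ f z := hf.differentiableAt
        (isOpen_ball.mem_nhds (ball_subset_ball hrρ.le hz.1))
      fun_prop
  rw [circleIntegral] at h
  have key : ∀ θ : ℝ, deriv (circleMap 0 r) θ • (circleMap 0 r θ ^ n * f (circleMap 0 r θ)) =
      (I * (r : ℂ) ^ (n + 1)) * (fourier (-(-((n : ℤ) + 1))) (θ : AddCircle (2 * π - 0)) •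
        f (circleMap 0 r θ)) := by
    intro θ
    rw [fourier_coe_apply, deriv_circleMap]
    simp only [circleMap, zero_add, sub_zero, smul_eq_mul]
    have he : cexp (2 * π * I * ((-(-((n : ℤ) + 1)) : ℤ) : ℂ) * θ / ((2 * π : ℝ) : ℂ)) =
        (cexp (θ * I) ^ (n + 1)) := by
      rw [← Complex.exp_nat_mul]
      congr 1
      have : (π : ℂ) ≠ 0 := by exact_mod_cast Real.pi_ne_zero
      push_cast
      field_simp
    rw [he, mul_pow]
    ring
  simp_rw [key] at h
  rw [intervalIntegral.integral_const_mul] at h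
  rw [fourierCoeffOn_eq_integral]
  have : I * (r : ℂ) ^ (n + 1) ≠ 0 := mul_ne_zero I_ne_zero (pow_ne_zero _ hr0)
  rw [(mul_eq_zero.1 h).resolve_left this, smul_zero]

/-- **Parseval's identity** for the Taylor coefficients of a holomorphic function on a circle. -/
lemma hasSum_sq_taylorCoeff {f : ℂ → ℂ} {ρ r : ℝ} (hf : DifferentiableOn ℂ f (ball 0 ρ))
    (hr : 0 < r) (hrρ : r < ρ) :
    HasSum (fun n : ℕ => ‖iteratedDeriv n f 0 / n.factorial‖ ^ 2 * r ^ (2 * n))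
      ((2 * π)⁻¹ * ∫ θ in (0 : ℝ)..2 * π, ‖f (circleMap 0 r θ)‖ ^ 2) := by
  have hcont : Continuous (fun θ => f (circleMap 0 r θ)) := by
    refine (hf.continuousOn.mono (closedBall_subset_ball hrρ)).comp_continuous
      (continuous_circleMap 0 r) fun θ => ?_
    exact circleMap_mem_closedBall 0 hr.le θ
  have hL2 : MemLp (fun θ => f (circleMap 0 r θ)) 2 (volume.restrict (Ioc 0 (2 * π))) := by
    obtain ⟨C, hC⟩ := (isCompact_sphere (0 : ℂ) r).exists_bound_of_continuousOn
      (hf.continuousOn.mono ((sphere_subset_closedBall).trans (closedBall_subset_ball hrρ)))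
    refine MemLp.of_bound hcont.aestronglyMeasurable C (Eventually.of_forall fun θ => ?_)
    exact hC _ (circleMap_mem_sphere 0 hr.le θ)
  have h := hasSum_sq_fourierCoeffOn (show (0 : ℝ) < 2 * π by positivity) hL2
  have h2 : HasSum (fun n : ℕ => ‖fourierCoeffOn (show (0 : ℝ) < 2 * π by positivity)
      (fun θ => f (circleMap 0 r θ)) (n : ℤ)‖ ^ 2)
      ((2 * π - 0)⁻¹ • ∫ θ in (0 : ℝ)..2 * π, ‖f (circleMap 0 r θ)‖ ^ 2) := by
    have hinj : Function.Injective (fun n : ℕ => (n : ℤ)) := Nat.cast_injective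
    refine (hinj.hasSum_iff (f := fun i : ℤ => ‖fourierCoeffOn _ _ i‖ ^ 2) ?_).2 h
    intro m hm
    obtain ⟨k, hk⟩ | ⟨k, hk⟩ : (∃ k : ℕ, m = k) ∨ ∃ k : ℕ, m = -((k : ℤ) + 1) := by
      rcases m with k | k
      · exact Or.inl ⟨k, rfl⟩
      · exact Or.inr ⟨k, by simp [Int.negSucc_eq]⟩
    · exact absurd ⟨k, hk.symm⟩ hm
    · subst hk
      rw [fourierCoeffOn_circleMap_neg hf hr hrρ k]
      simp
  simp_rw [fourierCoeffOn_circleMap_nat hf hr hrρ, sub_zero, smul_eq_mul] at h2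
  convert h2 using 2 with n
  rw [norm_mul, norm_pow, mul_pow, Complex.norm_real, Real.norm_of_nonneg hr.le]
  ring

end Parseval

section LittlewoodPaley

open Complex Metric
open scoped Real ENNReal

lemma setLIntegral_Ioc_eq_of_periodic {g : ℝ → ℝ≥0∞} (hg : ∀ θ, g (θ + 2 * π) = g θ) (a b : ℝ) :
    ∫⁻ θ in Ioc a (a + 2 * π), g θ = ∫⁻ θ in Ioc b (b + 2 * π), g θ := by
  have hpos : (0 : ℝ) < 2 * π := by positivity
  refine (isAddFundamentalDomain_Ioc hpos a).setLIntegral_eq (isAddFundamentalDomain_Ioc hpos b)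
    g fun y x => ?_
  obtain ⟨_, k, rfl⟩ := y
  have hper : Function.Periodic g (2 * π) := hg
  have := hper.int_mul k x
  change g ((k • (2 * π)) + x) = g x
  rw [add_comm, zsmul_eq_mul]
  exact this

/-- Integration over the unit disc in polar coordinates. -/
lemma lintegral_unitDisc_polar {g : ℂ → ℝ≥0∞} (hg : Measurable g) :
    ∫⁻ z in unitDisc, g z =
      ∫⁻ r in Ioo (0 : ℝ) 1, ENNReal.ofReal r * ∫⁻ θ in Ioc 0 (2 * π), g (circleMap 0 r θ) := by
  have hms : MeasurableSet unitDisc := by rw [unitDisc_eq_ball]; exact measurableSet_ball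
  rw [← lintegral_indicator hms, ← Complex.lintegral_comp_polarCoord_symm, polarCoord_target,
    Measure.volume_eq_prod, ← Measure.prod_restrict]
  have hcm : Measurable fun p : ℝ × ℝ => circleMap 0 p.1 p.2 := by
    unfold circleMap; fun_prop
  have hpc : ∀ p : ℝ × ℝ, Complex.polarCoord.symm p = circleMap 0 p.1 p.2 := by
    intro p
    rw [Complex.polarCoord_symm_apply, circleMap, zero_add, Complex.exp_mul_I]
    simp
  simp_rw [hpc]
  have hmeas : Measurable fun p : ℝ × ℝ =>
      ENNReal.ofReal p.1 • unitDisc.indicator g (circleMap 0 p.1 p.2) :=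
    (measurable_fst.ennreal_ofReal).smul ((hg.indicator hms).comp hcm)
  rw [lintegral_prod _ hmeas.aemeasurable]
  have hsub : Ioo (0 : ℝ) 1 ⊆ Ioi 0 := fun r hr => hr.1
  have hin : ∀ r ∈ Ioi (0 : ℝ), (∫⁻ θ in Ioo (-π) π,
      ENNReal.ofReal r • unitDisc.indicator g (circleMap 0 r θ)) =
      (Ioo (0 : ℝ) 1).indicator (fun r => ENNReal.ofReal r *
        ∫⁻ θ in Ioc 0 (2 * π), g (circleMap 0 r θ)) r := by
    intro r hr
    have hr0 : 0 < r := hr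
    by_cases h1 : r < 1
    · rw [indicator_of_mem (show r ∈ Ioo (0 : ℝ) 1 from ⟨hr, h1⟩)]
      have hmem : ∀ θ, circleMap 0 r θ ∈ unitDisc := fun θ => by
        simp [unitDisc, abs_of_pos hr0, h1]
      simp_rw [indicator_of_mem (hmem _), smul_eq_mul]
      rw [lintegral_const_mul' _ _ ENNReal.ofReal_ne_top,
        restrict_Ioo_eq_restrict_Ioc]
      congr 1
      have := setLIntegral_Ioc_eq_of_periodic (g := fun θ => g (circleMap 0 r θ))
        (fun θ => by rw [periodic_circleMap 0 r θ]) (-π) 0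
      rw [zero_add] at this
      rw [← this]
      congr 3
      ring
    · rw [indicator_of_notMem (fun h => h1 h.2)]
      have hmem : ∀ θ, circleMap 0 r θ ∉ unitDisc := fun θ => by
        simpa [unitDisc, abs_of_pos hr0] using h1
      simp_rw [indicator_of_notMem (hmem _)]
      simp
  rw [setLIntegral_congr_fun measurableSet_Ioi hin, lintegral_indicator measurableSet_Ioo,
    Measure.restrict_restrict measurableSet_Ioo, inter_eq_self_of_subset_left hsub]

lemma lintegral_circle_sq {f : ℂ → ℂ} {ρ r : ℝ} (hf : DifferentiableOn ℂ f (ball 0 ρ))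
    (hr : 0 < r) (hrρ : r < ρ) :
    ∫⁻ θ in Ioc 0 (2 * π), ENNReal.ofReal (‖f (circleMap 0 r θ)‖ ^ 2) =
      ENNReal.ofReal (2 * π) * ∑' n : ℕ,
        ENNReal.ofReal (‖iteratedDeriv n f 0 / n.factorial‖ ^ 2) * ENNReal.ofReal (r ^ (2 * n)) := by
  have h := hasSum_sq_taylorCoeff hf hr hrρ
  have hcont : Continuous (fun θ => f (circleMap 0 r θ)) := by
    refine (hf.continuousOn.mono (closedBall_subset_ball hrρ)).comp_continuous
      (continuous_circleMap 0 r) fun θ => ?_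
    exact circleMap_mem_closedBall 0 hr.le θ
  have hpos : (0 : ℝ) < 2 * π := by positivity
  simp_rw [← ENNReal.ofReal_mul (sq_nonneg _)]
  rw [← ENNReal.ofReal_tsum_of_nonneg (fun n => by positivity) h.summable, h.tsum_eq,
    ← ENNReal.ofReal_mul hpos.le, mul_inv_cancel_left₀ hpos.ne',
    intervalIntegral.integral_of_le hpos.le, ofReal_integral_eq_lintegral_ofReal]
  · exact (hcont.norm.pow 2).integrableOn_Ioc
  · exact Eventually.of_forall fun θ => by positivity

/-- The weighted Dirichlet integral of `f` on the unit disc. -/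
def dirichletEnergy (f : ℂ → ℂ) : ℝ≥0∞ :=
  ∫⁻ z in unitDisc, ENNReal.ofReal (‖deriv f z‖ ^ 2 * (1 - ‖z‖ ^ 2))

lemma lintegral_radial_weight (n : ℕ) :
    ∫⁻ r in Ioo (0 : ℝ) 1, ENNReal.ofReal (r * (1 - r ^ 2) * r ^ (2 * n)) =
      ENNReal.ofReal (1 / (2 * (n + 1) * (n + 2))) := by
  rw [restrict_Ioo_eq_restrict_Ioc, ← ofReal_integral_eq_lintegral_ofReal,
    ← intervalIntegral.integral_of_le zero_le_one]
  · congr 1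
    have : ∀ r : ℝ, r * (1 - r ^ 2) * r ^ (2 * n) = r ^ (2 * n + 1) - r ^ (2 * n + 3) := by
      intro r; ring
    simp_rw [this]
    rw [intervalIntegral.integral_sub (by simp) (by simp), integral_pow, integral_pow]
    push_cast
    field_simp
    ring
  · exact (by fun_prop : Continuous fun r : ℝ => r * (1 - r ^ 2) * r ^ (2 * n)).integrableOn_Ioc
  · filter_upwards [ae_restrict_mem measurableSet_Ioc] with r hr
    have : 0 ≤ 1 - r ^ 2 := by nlinarith [hr.1, hr.2]
    have := hr.1
    positivity

lemma dirichletEnergy_eq_tsum {f : ℂ → ℂ} {ρ : ℝ} (hρ : 1 < ρ)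
    (hf : DifferentiableOn ℂ f (ball 0 ρ)) :
    dirichletEnergy f = ∑' n : ℕ, ENNReal.ofReal (π * ((n + 1) / (n + 2)) *
        ‖iteratedDeriv (n + 1) f 0 / (n + 1).factorial‖ ^ 2) := by
  have hf' : DifferentiableOn ℂ (deriv f) (ball 0 ρ) := hf.deriv isOpen_ball
  have hm : Measurable fun z : ℂ => ENNReal.ofReal (‖deriv f z‖ ^ 2 * (1 - ‖z‖ ^ 2)) := by
    have := measurable_deriv f
    fun_prop
  rw [dirichletEnergy, lintegral_unitDisc_polar hm]
  have hstep : ∀ r ∈ Ioo (0 : ℝ) 1, (ENNReal.ofReal r * ∫⁻ θ in Ioc 0 (2 * π),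
      ENNReal.ofReal (‖deriv f (circleMap 0 r θ)‖ ^ 2 * (1 - ‖circleMap 0 r θ‖ ^ 2))) =
      ∑' n : ℕ, ENNReal.ofReal (2 * π * ‖iteratedDeriv n (deriv f) 0 / n.factorial‖ ^ 2) *
        ENNReal.ofReal (r * (1 - r ^ 2) * r ^ (2 * n)) := by
    intro r hr
    have h1 : 0 ≤ 1 - r ^ 2 := by nlinarith [hr.1, hr.2]
    have h0 := hr.1.le
    simp_rw [norm_circleMap_zero, sq_abs, ENNReal.ofReal_mul (sq_nonneg _)]
    rw [lintegral_mul_const' _ _ ENNReal.ofReal_ne_top,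
      lintegral_circle_sq hf' hr.1 (hr.2.trans hρ), ← ENNReal.tsum_mul_left,
      ← ENNReal.tsum_mul_right, ← ENNReal.tsum_mul_left]
    refine tsum_congr fun n => ?_
    rw [← ENNReal.ofReal_mul (by positivity), ← ENNReal.ofReal_mul (by positivity),
      ← ENNReal.ofReal_mul (by positivity), ← ENNReal.ofReal_mul (by positivity),
      ← ENNReal.ofReal_mul (by positivity)]
    congr 1
    ring
  rw [setLIntegral_congr_fun measurableSet_Ioo hstep, lintegral_tsum (fun n => by fun_prop)]
  refine tsum_congr fun n => ?_
  rw [lintegral_const_mul' _ _ ENNReal.ofReal_ne_top, lintegral_radial_weight,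
    ← ENNReal.ofReal_mul (by positivity), ← iteratedDeriv_succ']
  congr 1
  rw [norm_div, norm_div, Complex.norm_natCast, Complex.norm_natCast, Nat.factorial_succ]
  have : (n.factorial : ℝ) ≠ 0 := by exact_mod_cast n.factorial_ne_zero
  push_cast
  field_simp

lemma lintegral_circle_sq_eq {f : ℂ → ℂ} {ρ : ℝ} (hρ : 1 < ρ)
    (hf : DifferentiableOn ℂ f (ball 0 ρ)) :
    ∫⁻ θ in Ioc 0 (2 * π), ENNReal.ofReal (‖f (circlePt θ)‖ ^ 2) =
      ENNReal.ofReal (2 * π * ‖f 0‖ ^ 2) + ∑' n : ℕ, ENNReal.ofReal (2 * π *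
        ‖iteratedDeriv (n + 1) f 0 / (n + 1).factorial‖ ^ 2) := by
  have h := lintegral_circle_sq hf one_pos hρ
  simp_rw [circleMap_zero_eq] at h
  simp only [Complex.ofReal_one, one_mul, one_pow, ENNReal.ofReal_one, mul_one] at h
  rw [h, tsum_eq_zero_add' ENNReal.summable, mul_add, ← ENNReal.tsum_mul_left]
  simp only [iteratedDeriv_zero, Nat.factorial_zero, Nat.cast_one, div_one]
  simp_rw [ENNReal.ofReal_mul (show (0 : ℝ) ≤ 2 * π by positivity)]

/-- Upper Littlewood–Paley inequality. -/
lemma lintegral_circle_sq_le {f : ℂ → ℂ} {ρ : ℝ} (hρ : 1 < ρ)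
    (hf : DifferentiableOn ℂ f (ball 0 ρ)) :
    ∫⁻ θ in Ioc 0 (2 * π), ENNReal.ofReal (‖f (circlePt θ)‖ ^ 2) ≤
      ENNReal.ofReal (2 * π * ‖f 0‖ ^ 2) + 4 * dirichletEnergy f := by
  rw [lintegral_circle_sq_eq hρ hf, dirichletEnergy_eq_tsum hρ hf, ← ENNReal.tsum_mul_left]
  gcongr with n
  rw [show (4 : ℝ≥0∞) = ENNReal.ofReal 4 by norm_num, ← ENNReal.ofReal_mul (by norm_num)]
  refine ENNReal.ofReal_le_ofReal ?_
  rw [← mul_assoc]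
  refine mul_le_mul_of_nonneg_right ?_ (by positivity)
  have h : (1 : ℝ) / 2 ≤ (n + 1) / (n + 2) := by
    rw [div_le_div_iff₀ (by norm_num) (by positivity)]
    have : (0 : ℝ) ≤ n := n.cast_nonneg
    linarith
  nlinarith [Real.pi_pos]

/-- Lower Littlewood–Paley inequality. -/
lemma two_mul_dirichletEnergy_le {f : ℂ → ℂ} {ρ : ℝ} (hρ : 1 < ρ)
    (hf : DifferentiableOn ℂ f (ball 0 ρ)) :
    2 * dirichletEnergy f ≤
      ∫⁻ θ in Ioc 0 (2 * π), ENNReal.ofReal (‖f (circlePt θ)‖ ^ 2) := by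
  rw [lintegral_circle_sq_eq hρ hf, dirichletEnergy_eq_tsum hρ hf, ← ENNReal.tsum_mul_left]
  refine le_trans ?_ le_add_self
  gcongr with n
  rw [show (2 : ℝ≥0∞) = ENNReal.ofReal 2 by norm_num, ← ENNReal.ofReal_mul (by norm_num)]
  refine ENNReal.ofReal_le_ofReal ?_
  rw [← mul_assoc]
  refine mul_le_mul_of_nonneg_right ?_ (by positivity)
  have h : ((n : ℝ) + 1) / (n + 2) ≤ 1 := by
    rw [div_le_one (by positivity)]
    linarith
  nlinarith [Real.pi_pos]

end LittlewoodPaley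

section Oscillation

open Complex Metric
open scoped Real ENNReal ComplexConjugate

lemma continuous_circlePt : Continuous circlePt := by
  unfold circlePt; fun_prop

@[simp] lemma norm_circlePt (θ : ℝ) : ‖circlePt θ‖ = 1 := Complex.norm_exp_ofReal_mul_I θ

lemma continuous_comp_circlePt {E : Type*} [TopologicalSpace E] {f : ℂ → E} {ρ : ℝ} (hρ : 1 < ρ)
    (hf : ContinuousOn f (ball 0 ρ)) : Continuous fun θ => f (circlePt θ) :=
  hf.comp_continuous continuous_circlePt fun θ => by simpa using hρ

/-- Termwise upper Littlewood–Paley inequality for power series in `|f|²`. -/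
lemma lintegral_series_le {f : ℂ → ℂ} {ρ : ℝ} (hρ : 1 < ρ)
    (hf : DifferentiableOn ℂ f (ball 0 ρ)) (c : ℕ → ℝ≥0∞) :
    ∫⁻ θ in Ioc 0 (2 * π), ∑' n : ℕ, c n * ENNReal.ofReal (‖f (circlePt θ)‖ ^ (2 * n)) ≤
      ENNReal.ofReal (2 * π) * ∑' n : ℕ, c n * ENNReal.ofReal (‖f 0‖ ^ (2 * n)) +
      4 * ∫⁻ z in unitDisc, (∑' n : ℕ, c n * ENNReal.ofReal (n ^ 2 * ‖f z‖ ^ (2 * (n - 1)))) *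
        ENNReal.ofReal (‖deriv f z‖ ^ 2 * (1 - ‖z‖ ^ 2)) := by
  have hc : Continuous fun θ => f (circlePt θ) := continuous_comp_circlePt hρ hf.continuousOn
  have hms : MeasurableSet unitDisc := by rw [unitDisc_eq_ball]; exact measurableSet_ball
  have hfm : AEMeasurable f (volume.restrict unitDisc) := by
    rw [unitDisc_eq_ball]
    exact (hf.continuousOn.mono (ball_subset_ball hρ.le)).aemeasurable measurableSet_ball
  have hdm := measurable_deriv f
  rw [lintegral_tsum fun n => ((hc.measurable.norm.pow_const _).ennreal_ofReal.const_mul _).aemeasurable]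
  simp_rw [← ENNReal.tsum_mul_right]
  rw [lintegral_tsum fun n => by fun_prop, ← ENNReal.tsum_mul_left, ← ENNReal.tsum_mul_left,
    ← ENNReal.tsum_add]
  refine ENNReal.tsum_le_tsum fun n => ?_
  have h := lintegral_circle_sq_le hρ (hf.pow n)
  have hd : dirichletEnergy (f ^ n) = ∫⁻ z in unitDisc,
      ENNReal.ofReal (n ^ 2 * ‖f z‖ ^ (2 * (n - 1))) *
        ENNReal.ofReal (‖deriv f z‖ ^ 2 * (1 - ‖z‖ ^ 2)) := by
    refine setLIntegral_congr_fun hms fun z hz => ?_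
    have hz' : z ∈ ball (0 : ℂ) ρ := by
      rw [unitDisc_eq_ball] at hz; exact ball_subset_ball hρ.le hz
    have hfd := hf.differentiableAt (isOpen_ball.mem_nhds hz')
    rw [← ENNReal.ofReal_mul (by positivity), deriv_pow hfd]
    congr 1
    simp only [norm_mul, norm_pow, Complex.norm_natCast]
    ring
  calc ∫⁻ θ in Ioc 0 (2 * π), c n * ENNReal.ofReal (‖f (circlePt θ)‖ ^ (2 * n))
      = c n * ∫⁻ θ in Ioc 0 (2 * π), ENNReal.ofReal (‖(f ^ n) (circlePt θ)‖ ^ 2) := by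
        have hm : Measurable fun θ => ENNReal.ofReal (‖(f ^ n) (circlePt θ)‖ ^ 2) :=
          ((hc.measurable.pow_const n).norm.pow_const 2).ennreal_ofReal
        rw [← lintegral_const_mul _ hm]
        simp only [Pi.pow_apply, norm_pow, ← pow_mul, mul_comm]
    _ ≤ c n * (ENNReal.ofReal (2 * π * ‖(f ^ n) 0‖ ^ 2) + 4 * dirichletEnergy (f ^ n)) := by
        gcongr
    _ = _ := by
        have e : ∀ z, c n * ENNReal.ofReal (n ^ 2 * ‖f z‖ ^ (2 * (n - 1))) *
            ENNReal.ofReal (‖deriv f z‖ ^ 2 * (1 - ‖z‖ ^ 2)) = c n *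
            (ENNReal.ofReal (n ^ 2 * ‖f z‖ ^ (2 * (n - 1))) *
              ENNReal.ofReal (‖deriv f z‖ ^ 2 * (1 - ‖z‖ ^ 2))) := fun z => mul_assoc _ _ _
        simp_rw [e]
        rw [lintegral_const_mul'' _ (by fun_prop), hd, mul_add,
          ENNReal.ofReal_mul (by positivity : (0 : ℝ) ≤ 2 * π)]
        simp only [Pi.pow_apply, norm_pow, ← pow_mul]
        rw [mul_comm n 2]
        ring

/-- The function `w ↦ -log (1 - |w|²)`. -/
def logDefect (w : ℂ) : ℝ := -Real.log (1 - ‖w‖ ^ 2)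

lemma logDefect_nonneg {w : ℂ} (hw : ‖w‖ < 1) : 0 ≤ logDefect w := by
  have := norm_nonneg w
  exact neg_nonneg.2 (Real.log_nonpos (by nlinarith) (by nlinarith))

lemma continuousOn_logDefect : ContinuousOn logDefect {w | ‖w‖ < 1} := by
  unfold logDefect
  refine (ContinuousOn.log (by fun_prop) fun w hw => ?_).neg
  have := norm_nonneg w
  have hw : ‖w‖ < 1 := hw
  nlinarith

lemma lintegral_logDefect_le {B : ℂ → ℂ} {ρ : ℝ} (hρ : 1 < ρ)
    (hB : DifferentiableOn ℂ B (ball 0 ρ)) (hB1 : ∀ z ∈ ball (0 : ℂ) ρ, ‖B z‖ < 1)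
    (hB0 : B 0 = 0) :
    ∫⁻ θ in Ioc 0 (2 * π), ENNReal.ofReal (logDefect (B (circlePt θ))) ≤
      4 * ∫⁻ z in unitDisc, hypDensity B z := by
  have hms : MeasurableSet unitDisc := by rw [unitDisc_eq_ball]; exact measurableSet_ball
  have h := lintegral_series_le hρ hB fun n => ENNReal.ofReal (n : ℝ)⁻¹
  have h0 : ∑' n : ℕ, ENNReal.ofReal (n : ℝ)⁻¹ * ENNReal.ofReal (‖B 0‖ ^ (2 * n)) = 0 := by
    rw [ENNReal.tsum_eq_zero]
    intro n
    rcases n with _ | n <;> simp [hB0]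
  rw [h0, mul_zero, zero_add] at h
  convert h using 2
  · ext θ
    have hq : ‖B (circlePt θ)‖ < 1 := hB1 _ (by simpa using hρ)
    have hq0 := norm_nonneg (B (circlePt θ))
    have hs := Real.hasSum_pow_div_log_of_abs_lt_one (x := ‖B (circlePt θ)‖ ^ 2)
      (by rw [abs_of_nonneg (by positivity)]; nlinarith)
    rw [logDefect, ← hs.tsum_eq, ENNReal.ofReal_tsum_of_nonneg (fun n => by positivity) hs.summable,
      tsum_eq_zero_add' (f := fun n : ℕ => ENNReal.ofReal (n : ℝ)⁻¹ * _) ENNReal.summable]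
    simp only [Nat.cast_zero, inv_zero, ENNReal.ofReal_zero, zero_mul, zero_add]
    refine tsum_congr fun n => ?_
    rw [← ENNReal.ofReal_mul (by positivity), ← pow_mul]
    congr 1
    push_cast
    field_simp
  · refine setLIntegral_congr_fun hms fun z hz => ?_
    have hz1 : ‖z‖ < 1 := hz
    have hq : ‖B z‖ < 1 := hB1 _ (by simpa using hz1.trans hρ)
    have hq0 := norm_nonneg (B z)
    have hs := hasSum_choose_mul_geometric_of_norm_lt_one (𝕜 := ℝ) 1 (r := ‖B z‖ ^ 2)
      (by rw [Real.norm_of_nonneg (by positivity)]; nlinarith)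
    rw [tsum_eq_zero_add' (f := fun n : ℕ => ENNReal.ofReal (n : ℝ)⁻¹ * _) ENNReal.summable]
    simp only [Nat.cast_zero, inv_zero, ENNReal.ofReal_zero, zero_mul, zero_add]
    have : ∀ n : ℕ, ENNReal.ofReal ((n + 1 : ℕ) : ℝ)⁻¹ *
        ENNReal.ofReal (((n + 1 : ℕ) : ℝ) ^ 2 * ‖B z‖ ^ (2 * (n + 1 - 1))) =
        ENNReal.ofReal (((n + 1).choose 1 : ℕ) * (‖B z‖ ^ 2) ^ n) := by
      intro n
      rw [← ENNReal.ofReal_mul (by positivity), ← pow_mul, Nat.choose_one_right,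
        Nat.add_sub_cancel]
      congr 1
      push_cast
      field_simp
    simp_rw [this]
    rw [← ENNReal.ofReal_tsum_of_nonneg (fun n => by positivity) hs.summable, hs.tsum_eq,
      ← ENNReal.ofReal_mul (by have : 0 ≤ 1 - ‖B z‖ ^ 2 := by nlinarith
                               positivity), hypDensity]
    congr 1
    ring

lemma one_sub_conj_mul_re_pos {b w : ℂ} (hb : ‖b‖ < 1) (hw : ‖w‖ < 1) :
    0 < (1 - conj b * w).re := by
  have h : (conj b * w).re ≤ ‖conj b * w‖ := Complex.re_le_norm _
  rw [norm_mul, Complex.norm_conj] at h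
  have := norm_nonneg b
  have := norm_nonneg w
  simp only [Complex.sub_re, Complex.one_re]
  nlinarith

lemma one_sub_conj_mul_ne_zero {b w : ℂ} (hb : ‖b‖ < 1) (hw : ‖w‖ < 1) :
    1 - conj b * w ≠ 0 := fun h => by
  have := one_sub_conj_mul_re_pos hb hw
  rw [h] at this
  simp at this

lemma norm_sq_one_sub_conj_mul (b w : ℂ) :
    ‖1 - conj b * w‖ ^ 2 = ‖w - b‖ ^ 2 + (1 - ‖b‖ ^ 2) * (1 - ‖w‖ ^ 2) := by
  simp only [Complex.sq_norm, Complex.normSq_apply, Complex.sub_re, Complex.sub_im, Complex.mul_re,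
    Complex.mul_im, Complex.one_re, Complex.one_im, Complex.conj_re, Complex.conj_im]
  ring

lemma one_sub_norm_sq_moebius {b w : ℂ} (hb : ‖b‖ < 1) (hw : ‖w‖ < 1) :
    1 - ‖(w - b) / (1 - conj b * w)‖ ^ 2 =
      (1 - ‖b‖ ^ 2) * (1 - ‖w‖ ^ 2) / ‖1 - conj b * w‖ ^ 2 := by
  have h0 : ‖1 - conj b * w‖ ≠ 0 := norm_ne_zero_iff.2 (one_sub_conj_mul_ne_zero hb hw)
  rw [norm_div, div_pow, eq_div_iff (pow_ne_zero 2 h0), sub_mul, div_mul_cancel₀ _ (pow_ne_zero 2 h0),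
    norm_sq_one_sub_conj_mul]
  ring

lemma norm_moebius_lt_one {b w : ℂ} (hb : ‖b‖ < 1) (hw : ‖w‖ < 1) :
    ‖(w - b) / (1 - conj b * w)‖ < 1 := by
  have h := one_sub_norm_sq_moebius hb hw
  have h0 : 0 < ‖1 - conj b * w‖ := norm_pos_iff.2 (one_sub_conj_mul_ne_zero hb hw)
  have h1 : 0 < 1 - ‖b‖ ^ 2 := by have := norm_nonneg b; nlinarith
  have h2 : 0 < 1 - ‖w‖ ^ 2 := by have := norm_nonneg w; nlinarith
  have h3 : 0 < (1 - ‖b‖ ^ 2) * (1 - ‖w‖ ^ 2) / ‖1 - conj b * w‖ ^ 2 := by positivity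
  have := norm_nonneg ((w - b) / (1 - conj b * w))
  nlinarith

/-- The oscillation of `-log(1-|G|²)` on the circle about its value at the origin is controlled
by the hyperbolic area integral of `G`. -/
lemma lintegral_logDefect_sub_le {G : ℂ → ℂ} {ρ η : ℝ} (hρ : 1 < ρ) (hη : 0 < η)
    (hG : DifferentiableOn ℂ G (ball 0 ρ)) (hG1 : ∀ z ∈ ball (0 : ℂ) ρ, ‖G z‖ < 1) :
    ∫⁻ θ in Ioc 0 (2 * π), ENNReal.ofReal |logDefect (G (circlePt θ)) - logDefect (G 0)| ≤
      4 * (∫⁻ z in unitDisc, hypDensity G z) + ENNReal.ofReal (2 * π * η) +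
        ENNReal.ofReal (16 / η) * ∫⁻ z in unitDisc, hypDensity G z := by
  have hms : MeasurableSet unitDisc := by rw [unitDisc_eq_ball]; exact measurableSet_ball
  have h0mem : (0 : ℂ) ∈ ball (0 : ℂ) ρ := by simpa using one_pos.trans hρ
  set b := G 0 with hb
  have hb1 : ‖b‖ < 1 := hG1 0 h0mem
  have hbd : 0 < 1 - ‖b‖ ^ 2 := by have := norm_nonneg b; nlinarith
  set B : ℂ → ℂ := fun z => (G z - b) / (1 - conj b * G z) with hBdef
  set ℓ : ℂ → ℂ := fun z => Complex.log ((1 - conj b * G z) / ((1 - ‖b‖ ^ 2 : ℝ) : ℂ)) with hℓdef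
  have hslit : ∀ z ∈ ball (0 : ℂ) ρ,
      (1 - conj b * G z) / ((1 - ‖b‖ ^ 2 : ℝ) : ℂ) ∈ Complex.slitPlane := fun z hz => by
    left
    rw [Complex.div_ofReal_re]
    exact div_pos (one_sub_conj_mul_re_pos hb1 (hG1 z hz)) hbd
  have hne : ∀ z ∈ ball (0 : ℂ) ρ, 1 - conj b * G z ≠ 0 := fun z hz =>
    one_sub_conj_mul_ne_zero hb1 (hG1 z hz)
  have hBd : DifferentiableOn ℂ B (ball 0 ρ) :=
    (hG.sub_const b).div ((hG.const_mul _).const_sub 1) hne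
  have hB1 : ∀ z ∈ ball (0 : ℂ) ρ, ‖B z‖ < 1 := fun z hz => norm_moebius_lt_one hb1 (hG1 z hz)
  have hB0 : B 0 = 0 := by simp [hBdef, ← hb]
  have hℓd : DifferentiableOn ℂ ℓ (ball 0 ρ) :=
    (((hG.const_mul _).const_sub 1).div_const _).clog hslit
  have hℓ0 : ℓ 0 = 0 := by
    have : (1 - conj b * b) = ((1 - ‖b‖ ^ 2 : ℝ) : ℂ) := by
      rw [Complex.conj_mul']; push_cast; rfl
    simp only [hℓdef]
    rw [← hb, this, div_self (by exact_mod_cast hbd.ne'), Complex.log_one]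
  have hid : ∀ z ∈ ball (0 : ℂ) ρ,
      logDefect (G z) - logDefect b = logDefect (B z) - 2 * (ℓ z).re := fun z hz => by
    have hw := hG1 z hz
    have hwd : 0 < 1 - ‖G z‖ ^ 2 := by have := norm_nonneg (G z); nlinarith
    have hn : 0 < ‖1 - conj b * G z‖ := norm_pos_iff.2 (hne z hz)
    simp only [logDefect, hBdef, hℓdef]
    rw [one_sub_norm_sq_moebius hb1 hw, Complex.log_re, norm_div, Complex.norm_real,
      Real.norm_of_nonneg hbd.le, Real.log_div (by positivity) (by positivity),
      Real.log_div (by positivity) (by positivity), Real.log_mul hbd.ne' hwd.ne', Real.log_pow]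
    push_cast
    ring
  have hpt : ∀ z ∈ ball (0 : ℂ) ρ, |logDefect (G z) - logDefect b| ≤
      logDefect (B z) + η + η⁻¹ * ‖ℓ z‖ ^ 2 := fun z hz => by
    have h1 := logDefect_nonneg (hB1 z hz)
    have h2 : 2 * ‖ℓ z‖ ≤ η + η⁻¹ * ‖ℓ z‖ ^ 2 := by
      have : 0 ≤ η⁻¹ * (‖ℓ z‖ - η) ^ 2 := by positivity
      have e : η⁻¹ * (‖ℓ z‖ - η) ^ 2 = η⁻¹ * ‖ℓ z‖ ^ 2 - 2 * ‖ℓ z‖ + η := by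
        field_simp
        ring
      linarith
    have h3 := Complex.abs_re_le_norm (ℓ z)
    rw [hid z hz]
    have h4 := abs_sub (logDefect (B z)) (2 * (ℓ z).re)
    rw [abs_of_nonneg h1, abs_mul, abs_two] at h4
    linarith
  have hBhyp : ∫⁻ z in unitDisc, hypDensity B z = ∫⁻ z in unitDisc, hypDensity G z := by
    refine setLIntegral_congr_fun hms fun z hz => ?_
    have hz1 : ‖z‖ < 1 := hz
    have hz' : z ∈ ball (0 : ℂ) ρ := by simpa using hz1.trans hρ
    have hGd := (hG.differentiableAt (isOpen_ball.mem_nhds hz')).hasDerivAt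
    have hder : HasDerivAt B (deriv G z * ((1 - ‖b‖ ^ 2 : ℝ) : ℂ) / (1 - conj b * G z) ^ 2) z := by
      refine ((hGd.sub_const b).div ((hGd.const_mul (conj b)).const_sub 1)
        (hne z hz')).congr_deriv ?_
      congr 1
      push_cast
      rw [← Complex.conj_mul']
      ring
    have hwd : 0 < 1 - ‖G z‖ ^ 2 := by
      have := norm_nonneg (G z); have := hG1 z hz'; nlinarith
    have hn : 0 < ‖1 - conj b * G z‖ := norm_pos_iff.2 (hne z hz')
    simp only [hypDensity]
    rw [hder.deriv, one_sub_norm_sq_moebius hb1 (hG1 z hz')]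
    simp only [norm_div, norm_mul, norm_pow, Complex.norm_real, Real.norm_of_nonneg hbd.le]
    congr 1
    field_simp
  have hℓe : dirichletEnergy ℓ ≤ 4 * ∫⁻ z in unitDisc, hypDensity G z := by
    rw [← lintegral_const_mul' _ _ (by norm_num)]
    refine setLIntegral_mono' hms fun z hz => ?_
    have hz1 : ‖z‖ < 1 := hz
    have hzd : 0 ≤ 1 - ‖z‖ ^ 2 := by have := norm_nonneg z; nlinarith
    have hz' : z ∈ ball (0 : ℂ) ρ := by simpa using hz1.trans hρ
    have hGd := (hG.differentiableAt (isOpen_ball.mem_nhds hz')).hasDerivAt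
    have hder : HasDerivAt ℓ (-(conj b * deriv G z) / (1 - conj b * G z)) z := by
      refine ((((hGd.const_mul (conj b)).const_sub 1).div_const
        ((1 - ‖b‖ ^ 2 : ℝ) : ℂ)).clog (hslit z hz')).congr_deriv ?_
      have h1 : ((1 - ‖b‖ ^ 2 : ℝ) : ℂ) ≠ 0 := by exact_mod_cast hbd.ne'
      have h2 := hne z hz'
      field_simp
    have hw := hG1 z hz'
    have hw0 := norm_nonneg (G z)
    have hb0 := norm_nonneg b
    have hwd : 0 < 1 - ‖G z‖ ^ 2 := by nlinarith
    have hn : 1 - ‖G z‖ ≤ ‖1 - conj b * G z‖ := by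
      have h1 := norm_sub_norm_le (1 : ℂ) (conj b * G z)
      rw [norm_one, norm_mul, Complex.norm_conj] at h1
      nlinarith
    have hle : ‖-(conj b * deriv G z) / (1 - conj b * G z)‖ ≤
        2 * ‖deriv G z‖ / (1 - ‖G z‖ ^ 2) := by
      have hn0 : 0 < ‖1 - conj b * G z‖ := by linarith
      rw [norm_div, norm_neg, norm_mul, Complex.norm_conj, div_le_div_iff₀ hn0 hwd]
      have hd := norm_nonneg (deriv G z)
      have e1 : ‖b‖ * ‖deriv G z‖ ≤ ‖deriv G z‖ := by nlinarith
      have e2 : 1 - ‖G z‖ ^ 2 ≤ 2 * ‖1 - conj b * G z‖ := by nlinarith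
      calc ‖b‖ * ‖deriv G z‖ * (1 - ‖G z‖ ^ 2)
          ≤ ‖deriv G z‖ * (2 * ‖1 - conj b * G z‖) := by gcongr
        _ = _ := by ring
    rw [hder.deriv, hypDensity, show (4 : ℝ≥0∞) = ENNReal.ofReal 4 by norm_num,
      ← ENNReal.ofReal_mul (by norm_num)]
    refine ENNReal.ofReal_le_ofReal ?_
    calc _ ≤ (2 * ‖deriv G z‖ / (1 - ‖G z‖ ^ 2)) ^ 2 * (1 - ‖z‖ ^ 2) := by gcongr
      _ = _ := by
        field_simp
        ring
  have hℓi : ∫⁻ θ in Ioc 0 (2 * π), ENNReal.ofReal (‖ℓ (circlePt θ)‖ ^ 2) ≤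
      16 * ∫⁻ z in unitDisc, hypDensity G z := by
    refine (lintegral_circle_sq_le hρ hℓd).trans ?_
    rw [hℓ0, norm_zero, zero_pow two_ne_zero, mul_zero, ENNReal.ofReal_zero, zero_add]
    calc 4 * dirichletEnergy ℓ ≤ 4 * (4 * ∫⁻ z in unitDisc, hypDensity G z) := by gcongr
      _ = _ := by rw [← mul_assoc]; norm_num
  have hBi := lintegral_logDefect_le hρ hBd hB1 hB0
  rw [hBhyp] at hBi
  have hcB : Continuous fun θ => logDefect (B (circlePt θ)) :=
    continuous_comp_circlePt (f := fun z => logDefect (B z)) hρ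
      (continuousOn_logDefect.comp hBd.continuousOn hB1)
  have hcℓ : Continuous fun θ => ℓ (circlePt θ) := continuous_comp_circlePt hρ hℓd.continuousOn
  calc _ ≤ ∫⁻ θ in Ioc 0 (2 * π), (ENNReal.ofReal (logDefect (B (circlePt θ))) +
        ENNReal.ofReal η + ENNReal.ofReal η⁻¹ * ENNReal.ofReal (‖ℓ (circlePt θ)‖ ^ 2)) := by
        refine lintegral_mono fun θ => ?_
        have hm : circlePt θ ∈ ball (0 : ℂ) ρ := by simpa using hρ
        have h1 := logDefect_nonneg (hB1 _ hm)
        rw [← ENNReal.ofReal_mul (by positivity), ← ENNReal.ofReal_add h1 hη.le,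
          ← ENNReal.ofReal_add (by positivity) (by positivity)]
        exact ENNReal.ofReal_le_ofReal (hpt _ hm)
    _ = (∫⁻ θ in Ioc 0 (2 * π), ENNReal.ofReal (logDefect (B (circlePt θ)))) +
        ENNReal.ofReal (2 * π * η) + ENNReal.ofReal η⁻¹ *
          ∫⁻ θ in Ioc 0 (2 * π), ENNReal.ofReal (‖ℓ (circlePt θ)‖ ^ 2) := by
        rw [lintegral_add_left (by have := hcB.measurable; fun_prop),
          lintegral_add_left (by have := hcB.measurable; fun_prop),
          lintegral_const_mul' _ _ ENNReal.ofReal_ne_top, lintegral_const,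
          Measure.restrict_apply_univ, Real.volume_Ioc, sub_zero, mul_comm (2 * π),
          ENNReal.ofReal_mul hη.le]
    _ ≤ 4 * (∫⁻ z in unitDisc, hypDensity G z) + ENNReal.ofReal (2 * π * η) +
        ENNReal.ofReal η⁻¹ * (16 * ∫⁻ z in unitDisc, hypDensity G z) := by
        gcongr
    _ = _ := by
        rw [div_eq_inv_mul, ENNReal.ofReal_mul (by positivity : 0 ≤ η⁻¹), mul_assoc]
        simp only [ENNReal.ofReal_ofNat, mul_assoc]

end Oscillation

section DiscAutomorphism

open Complex Metric
open scoped Real ENNReal ComplexConjugate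

/-- The automorphism of the unit disc that sends `b` to `0`. -/
def discAut (b w : ℂ) : ℂ := (w - b) / (1 - conj b * w)

/-- The kernel `(1 - |b|²) / |1 - b̄ w|²`, which is the Poisson kernel when `|w| = 1`. -/
def discKernel (b w : ℂ) : ℝ := (1 - ‖b‖ ^ 2) / ‖1 - conj b * w‖ ^ 2

lemma one_sub_conj_mul_ne_zero_of_le {b w : ℂ} (hb : ‖b‖ < 1) (hw : ‖w‖ ≤ 1) :
    1 - conj b * w ≠ 0 := fun h => by
  have h1 : ‖conj b * w‖ = 1 := by rw [← sub_eq_zero.1 h, norm_one]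
  rw [norm_mul, Complex.norm_conj] at h1
  have := norm_nonneg b
  nlinarith

lemma one_sub_norm_sq_pos {b : ℂ} (hb : ‖b‖ < 1) : 0 < 1 - ‖b‖ ^ 2 := by
  have := norm_nonneg b
  nlinarith

lemma discKernel_pos {b w : ℂ} (hb : ‖b‖ < 1) (hw : ‖w‖ ≤ 1) : 0 < discKernel b w := by
  have := norm_pos_iff.2 (one_sub_conj_mul_ne_zero_of_le hb hw)
  have := one_sub_norm_sq_pos hb
  unfold discKernel
  positivity

lemma continuous_discKernel_circlePt {b : ℂ} (hb : ‖b‖ < 1) :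
    Continuous fun θ => discKernel b (circlePt θ) := by
  unfold discKernel
  have := continuous_circlePt
  refine Continuous.div (by fun_prop) (by fun_prop) fun θ => ?_
  exact pow_ne_zero 2 (norm_ne_zero_iff.2 (one_sub_conj_mul_ne_zero_of_le hb (by simp)))

lemma norm_discAut_of_norm_eq_one {b w : ℂ} (hb : ‖b‖ < 1) (hw : ‖w‖ = 1) :
    ‖discAut b w‖ = 1 := by
  have h := norm_sq_one_sub_conj_mul b w
  rw [hw, one_pow, sub_self, mul_zero, add_zero] at h
  have h2 : ‖1 - conj b * w‖ = ‖w - b‖ := by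
    rwa [sq_eq_sq₀ (norm_nonneg _) (norm_nonneg _)] at h
  rw [discAut, norm_div, h2, div_self]
  rw [← h2]
  exact norm_ne_zero_iff.2 (one_sub_conj_mul_ne_zero_of_le hb hw.le)

lemma discAut_neg_discAut {b w : ℂ} (hb : ‖b‖ < 1) (hw : ‖w‖ ≤ 1) :
    discAut (-b) (discAut b w) = w := by
  have h1 := one_sub_conj_mul_ne_zero_of_le hb hw
  have hd : (1 - conj b * b) ≠ 0 := one_sub_conj_mul_ne_zero hb hb
  unfold discAut
  rw [map_neg, neg_mul, sub_neg_eq_add, sub_neg_eq_add]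
  have e1 : (w - b) / (1 - conj b * w) + b = w * (1 - conj b * b) / (1 - conj b * w) := by
    rw [div_add' _ _ _ h1]
    congr 1
    ring
  have e2 : 1 + conj b * ((w - b) / (1 - conj b * w)) = (1 - conj b * b) / (1 - conj b * w) := by
    rw [← mul_div_assoc, add_div' _ _ _ h1]
    congr 1
    ring
  rw [e1, e2, div_div_div_cancel_right₀ h1, mul_div_cancel_right₀ _ hd]

lemma hasDerivAt_discAut {b w : ℂ} (h : 1 - conj b * w ≠ 0) :
    HasDerivAt (discAut b) (((1 - ‖b‖ ^ 2 : ℝ) : ℂ) / (1 - conj b * w) ^ 2) w := by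
  refine (((hasDerivAt_id w).sub_const b).div (((hasDerivAt_id w).const_mul (conj b)).const_sub 1)
    h).congr_deriv ?_
  congr 1
  push_cast
  rw [← Complex.conj_mul']
  simp only [id]
  ring

lemma hasDerivAt_circlePt (θ : ℝ) : HasDerivAt circlePt (I * circlePt θ) θ := by
  unfold circlePt
  have h : HasDerivAt (fun θ : ℝ => (θ : ℂ) * I) I θ := by
    simpa using (Complex.ofRealCLM.hasDerivAt (x := θ)).mul_const I
  exact h.cexp.congr_deriv (by ring)

lemma circlePt_add_two_pi (θ : ℝ) : circlePt (θ + 2 * π) = circlePt θ := by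
  unfold circlePt
  push_cast
  rw [add_mul, Complex.exp_add, Complex.exp_two_pi_mul_I, mul_one]

lemma circleMap_zero_one (θ : ℝ) : circleMap 0 1 θ = circlePt θ := by
  rw [circleMap_zero_eq]
  simp

lemma discKernel_circlePt {b : ℂ} (θ : ℝ) :
    discKernel b (circlePt θ) = (1 - ‖b‖ ^ 2) / ‖circlePt θ - b‖ ^ 2 := by
  rw [discKernel, norm_sq_one_sub_conj_mul]
  simp

lemma integral_discKernel {b : ℂ} (hb : ‖b‖ < 1) :
    ∫ θ in (0 : ℝ)..2 * π, discKernel b (circlePt θ) = 2 * π := by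
  have h := (diffContOnCl_const (c := (1 : ℝ → ℂ) 0) (s := ball (0 : ℂ) 1)
    (𝕜 := ℂ)).circleAverage_poissonKernel_smul' (w := b) (by simpa using hb)
  have h2 : ((∫ θ in (0 : ℝ)..2 * π, discKernel b (circlePt θ) : ℝ) : ℂ) = 2 * π := by
    rw [Real.circleAverage_def] at h
    simp only [circleMap_zero_one, norm_circlePt, sub_zero, one_pow, ← discKernel_circlePt,
      Pi.one_apply, Complex.real_smul, mul_one] at h
    rw [intervalIntegral.integral_ofReal] at h
    have hpi : ((2 * π : ℝ) : ℂ) ≠ 0 := by exact_mod_cast (by positivity : (2 * π : ℝ) ≠ 0)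
    rw [Complex.ofReal_inv, inv_mul_eq_one₀ hpi] at h
    rw [← h]
    push_cast
    rfl
  exact_mod_cast h2

/-- Change of variables on the circle under a disc automorphism. -/
lemma integral_circle_discAut {a : ℂ} (ha : ‖a‖ < 1) {K : ℂ → ℝ}
    (hK : ContinuousOn K (sphere 0 1)) :
    ∫ θ in (0 : ℝ)..2 * π, K (circlePt θ) * discKernel a (circlePt θ) =
      ∫ θ in (0 : ℝ)..2 * π, K (discAut (-a) (circlePt θ)) := by
  set κ : ℝ → ℝ := fun θ => discKernel a (circlePt θ) with hκ
  have hκc : Continuous κ := continuous_discKernel_circlePt ha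
  set φ₀ : ℝ := Complex.arg (discAut a (circlePt 0)) with hφ₀
  set φ : ℝ → ℝ := fun θ => φ₀ + ∫ t in (0 : ℝ)..θ, κ t with hφ
  have hφd : ∀ θ, HasDerivAt φ (κ θ) θ := fun θ =>
    (intervalIntegral.integral_hasDerivAt_right (hκc.intervalIntegrable _ _)
      (hκc.stronglyMeasurableAtFilter _ _) hκc.continuousAt).const_add φ₀
  have hφ0 : φ 0 = φ₀ := by simp [hφ]
  have hφ2 : φ (2 * π) = φ₀ + 2 * π := by
    simp only [hφ]
    rw [integral_discKernel ha]
  have hy : ∀ θ, HasDerivAt (fun θ => discAut a (circlePt θ) * circlePt (-φ θ)) 0 θ := by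
    intro θ
    have hw : ‖circlePt θ‖ = 1 := norm_circlePt θ
    have hne := one_sub_conj_mul_ne_zero_of_le ha hw.le
    have h1 : HasDerivAt (fun θ => discAut a (circlePt θ))
        (((1 - ‖a‖ ^ 2 : ℝ) : ℂ) / (1 - conj a * circlePt θ) ^ 2 * (I * circlePt θ)) θ :=
      (hasDerivAt_discAut hne).comp θ (hasDerivAt_circlePt θ)
    have h2 : HasDerivAt (fun θ => circlePt (-φ θ)) (-κ θ • (I * circlePt (-φ θ))) θ :=
      HasDerivAt.scomp (h := fun θ => -φ θ) θ (hasDerivAt_circlePt (-φ θ)) (hφd θ).neg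
    refine (h1.mul h2).congr_deriv ?_
    have hww : circlePt θ * conj (circlePt θ) = 1 := by
      rw [Complex.mul_conj', hw]; simp
    have hkap : (κ θ : ℂ) = ((1 - ‖a‖ ^ 2 : ℝ) : ℂ) /
        ((1 - conj a * circlePt θ) * (1 - a * conj (circlePt θ))) := by
      simp only [hκ, discKernel]
      rw [Complex.ofReal_div, Complex.ofReal_pow, ← Complex.mul_conj']
      simp
    have hne2 : 1 - a * conj (circlePt θ) ≠ 0 := by
      have := (map_ne_zero conj).2 hne
      simpa using this
    have hsub : circlePt θ - a = circlePt θ * (1 - a * conj (circlePt θ)) := by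
      linear_combination a * hww
    rw [Complex.real_smul, Complex.ofReal_neg, hkap, discAut, hsub]
    field_simp
    ring
  have hconst : ∀ θ, discAut a (circlePt θ) = circlePt (φ θ) := by
    intro θ
    have h1 := is_const_of_deriv_eq_zero (fun θ => (hy θ).differentiableAt)
      (fun θ => (hy θ).deriv) θ 0
    have hinv : ∀ x : ℝ, circlePt (-x) * circlePt x = 1 := fun x => by
      unfold circlePt
      rw [← Complex.exp_add]
      simp
    have h2 : discAut a (circlePt 0) = circlePt φ₀ := by
      have := Complex.norm_mul_exp_arg_mul_I (discAut a (circlePt 0))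
      rw [norm_discAut_of_norm_eq_one ha (norm_circlePt 0)] at this
      rw [Complex.ofReal_one, one_mul] at this
      exact this.symm
    simp only [hφ0] at h1
    rw [h2, mul_comm (circlePt φ₀), hinv] at h1
    calc _ = discAut a (circlePt θ) * circlePt (-φ θ) * circlePt (φ θ) := by
          rw [mul_assoc, hinv, mul_one]
      _ = _ := by rw [h1, one_mul]
  have ha' : ‖-a‖ < 1 := by rwa [norm_neg]
  set g : ℝ → ℝ := fun θ => K (discAut (-a) (circlePt θ)) with hg
  have hgc : Continuous g := by
    refine hK.comp_continuous ?_ fun θ => by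
      simpa using norm_discAut_of_norm_eq_one ha' (norm_circlePt θ)
    have := continuous_circlePt
    unfold discAut
    exact Continuous.div (by fun_prop) (by fun_prop) fun θ =>
      one_sub_conj_mul_ne_zero_of_le ha' (by simp)
  have hgp : Function.Periodic g (2 * π) := fun θ => by
    simp only [hg, circlePt_add_two_pi]
  calc ∫ θ in (0 : ℝ)..2 * π, K (circlePt θ) * κ θ
      = ∫ θ in (0 : ℝ)..2 * π, (g ∘ φ) θ * κ θ := by
        congr 1
        ext θ
        simp only [Function.comp, hg]
        rw [← hconst, discAut_neg_discAut ha (by simp)]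
    _ = ∫ θ in φ 0..φ (2 * π), g θ :=
        intervalIntegral.integral_comp_mul_deriv (fun x _ => hφd x) hκc.continuousOn hgc
    _ = _ := by
        rw [hφ0, hφ2, hgp.intervalIntegral_add_eq φ₀ 0, zero_add]

/-- The Poisson-type integral of the hyperbolic area measure of `F`. -/
def hypPotential (F : ℂ → ℂ) (b : ℂ) : ℝ≥0∞ :=
  ∫⁻ w in unitDisc, hypDensity F w * ENNReal.ofReal (discKernel b w)

lemma abs_det_restrictScalars_toSpanSingleton (c : ℂ) :
    |((ContinuousLinearMap.toSpanSingleton ℂ c).restrictScalars ℝ : ℂ →L[ℝ] ℂ).det| = ‖c‖ ^ 2 := by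
  have : ((ContinuousLinearMap.toSpanSingleton ℂ c).restrictScalars ℝ : ℂ →L[ℝ] ℂ).det =
      Complex.normSq c := by
    rw [← Algebra.norm_complex_apply, Algebra.norm_apply, ContinuousLinearMap.det]
    congr 1
    ext
    simp [mul_comm]
  rw [this, abs_of_nonneg (Complex.normSq_nonneg _), Complex.normSq_eq_norm_sq]

lemma discAut_zero (b : ℂ) : discAut b 0 = -b := by simp [discAut]

lemma norm_discAut_lt_one {b w : ℂ} (hb : ‖b‖ < 1) (hw : ‖w‖ < 1) : ‖discAut b w‖ < 1 :=
  norm_moebius_lt_one hb hw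

lemma one_sub_norm_sq_discAut {b w : ℂ} (hb : ‖b‖ < 1) (hw : ‖w‖ < 1) :
    1 - ‖discAut b w‖ ^ 2 = (1 - ‖w‖ ^ 2) * discKernel b w := by
  rw [discAut, one_sub_norm_sq_moebius hb hw, discKernel]
  ring

/-- Conformal invariance and the Schwarz lemma bound the hyperbolic area integral of
`z ↦ F (R τ(z))` for a disc automorphism `τ`. -/
lemma lintegral_hypDensity_comp_le {F : ℂ → ℂ} (hF : DifferentiableOn ℂ F unitDisc) {R : ℝ} {a : ℂ}
    (hR0 : 0 < R) (hR : R < 1) (ha : ‖a‖ < 1) :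
    ∫⁻ z in unitDisc, hypDensity (fun z => F (R * discAut (-a) z)) z ≤ hypPotential F (R * a) := by
  have hms : MeasurableSet unitDisc := by rw [unitDisc_eq_ball]; exact measurableSet_ball
  have hopen : IsOpen unitDisc := by rw [unitDisc_eq_ball]; exact isOpen_ball
  have ha' : ‖-a‖ < 1 := by rwa [norm_neg]
  set T : ℂ → ℂ := fun z => R * discAut (-a) z with hT
  set T' : ℂ → ℂ := fun z => R * (((1 - ‖-a‖ ^ 2 : ℝ) : ℂ) / (1 - conj (-a) * z) ^ 2) with hT'
  have hTd : ∀ z ∈ unitDisc, HasDerivAt T (T' z) z := fun z hz =>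
    (hasDerivAt_discAut (one_sub_conj_mul_ne_zero ha' hz)).const_mul _
  have hTm : ∀ z ∈ unitDisc, T z ∈ unitDisc := fun z hz => by
    have h1 := norm_discAut_lt_one ha' hz
    have h2 := norm_nonneg (discAut (-a) z)
    change ‖(R : ℂ) * discAut (-a) z‖ < 1
    rw [norm_mul, Complex.norm_real, Real.norm_of_nonneg hR0.le]
    nlinarith
  have hinj : InjOn T unitDisc := fun z hz w hw h => by
    have hRc : (R : ℂ) ≠ 0 := by exact_mod_cast hR0.ne'
    have h1 := mul_left_cancel₀ hRc h
    have hz' : ‖z‖ < 1 := hz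
    have hw' : ‖w‖ < 1 := hw
    rw [← discAut_neg_discAut ha' hz'.le, ← discAut_neg_discAut ha' hw'.le, h1]
  set b : ℂ := R * a with hb
  have hb1 : ‖b‖ < 1 := by
    have := norm_nonneg a
    rw [hb, norm_mul, Complex.norm_real, Real.norm_of_nonneg hR0.le]
    nlinarith
  have hT0 : T 0 = b := by simp [hT, discAut_zero, hb]
  have hschwarz : ∀ z ∈ unitDisc, ‖discAut b (T z)‖ ≤ ‖z‖ := fun z hz => by
    refine Complex.norm_le_norm_of_mapsTo_ball (R := 1) (f := fun z => discAut b (T z)) ?_ ?_ ?_ hz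
    · intro w hw
      rw [← unitDisc_eq_ball] at hw
      exact ((hasDerivAt_discAut (one_sub_conj_mul_ne_zero hb1 (hTm w hw))).comp w
        (hTd w hw)).differentiableAt.differentiableWithinAt
    · intro w hw
      rw [← unitDisc_eq_ball] at hw
      simpa using (norm_discAut_lt_one hb1 (hTm w hw)).le
    · simp [hT0, discAut]
  set g : ℂ → ℝ≥0∞ := fun w => hypDensity F w * ENNReal.ofReal (discKernel b w) with hg
  calc ∫⁻ z in unitDisc, hypDensity (fun z => F (R * discAut (-a) z)) z
      ≤ ∫⁻ z in unitDisc, ENNReal.ofReal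
          |((ContinuousLinearMap.toSpanSingleton ℂ (T' z)).restrictScalars ℝ : ℂ →L[ℝ] ℂ).det| *
            g (T z) := by
        refine setLIntegral_mono' hms fun z hz => ?_
        have hz1 : ‖z‖ < 1 := hz
        have hTz : ‖T z‖ < 1 := hTm z hz
        have hFd := (hF.differentiableAt (hopen.mem_nhds (hTm z hz))).hasDerivAt
        have hder : HasDerivAt (fun z => F (R * discAut (-a) z)) (deriv F (T z) * T' z) z :=
          hFd.comp z (hTd z hz)
        have hk := (discKernel_pos hb1 hTz.le).le
        have hT1 := one_sub_norm_sq_pos hTz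
        have hs := hschwarz z hz
        have hs' : 1 - ‖z‖ ^ 2 ≤ (1 - ‖T z‖ ^ 2) * discKernel b (T z) := by
          rw [← one_sub_norm_sq_discAut hb1 hTz]
          have := norm_nonneg (discAut b (T z))
          nlinarith
        rw [abs_det_restrictScalars_toSpanSingleton, hg]
        simp only [hypDensity]
        rw [hder.deriv, ← ENNReal.ofReal_mul (by positivity), ← ENNReal.ofReal_mul (by positivity)]
        refine ENNReal.ofReal_le_ofReal ?_
        rw [norm_mul]
        calc (‖deriv F (T z)‖ * ‖T' z‖) ^ 2 * (1 - ‖z‖ ^ 2) / (1 - ‖F (R * discAut (-a) z)‖ ^ 2) ^ 2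
            ≤ (‖deriv F (T z)‖ * ‖T' z‖) ^ 2 * ((1 - ‖T z‖ ^ 2) * discKernel b (T z)) /
              (1 - ‖F (T z)‖ ^ 2) ^ 2 := by gcongr
          _ = _ := by ring
    _ = ∫⁻ w in T '' unitDisc, g w :=
        (lintegral_image_eq_lintegral_abs_det_fderiv_mul volume hms
          (fun z hz => ((hTd z hz).hasFDerivAt.restrictScalars ℝ).hasFDerivWithinAt) hinj g).symm
    _ ≤ ∫⁻ w in unitDisc, g w :=
        lintegral_mono_set (by rintro _ ⟨z, hz, rfl⟩; exact hTm z hz)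

/-- The Poisson-weighted oscillation of `-log(1-|F|²)` on the circle of radius `R` about its
value at the point `Ra`. -/
lemma lintegral_oscillation_le {F : ℂ → ℂ} (hF : DifferentiableOn ℂ F unitDisc)
    (hmap : ∀ z ∈ unitDisc, F z ∈ unitDisc) {R η : ℝ} {a : ℂ}
    (hR0 : 0 < R) (hR : R < 1) (ha : ‖a‖ < 1) (hη : 0 < η) :
    ∫⁻ θ in Ioc 0 (2 * π), ENNReal.ofReal
        (|logDefect (F (R * circlePt θ)) - logDefect (F (R * a))| * discKernel a (circlePt θ)) ≤
      4 * hypPotential F (R * a) + ENNReal.ofReal (2 * π * η) +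
        ENNReal.ofReal (16 / η) * hypPotential F (R * a) := by
  have ha' : ‖-a‖ < 1 := by rwa [norm_neg]
  have hopen : IsOpen unitDisc := by rw [unitDisc_eq_ball]; exact isOpen_ball
  have hRn : ∀ z : ℂ, ‖(R : ℂ) * z‖ = R * ‖z‖ := fun z => by
    rw [norm_mul, Complex.norm_real, Real.norm_of_nonneg hR0.le]
  have hpos : (0 : ℝ) < 2 * π := by positivity
  set U : Set ℂ := {z | R * ‖z - -a‖ < ‖1 - conj (-a) * z‖} with hU
  have hUo : IsOpen U := isOpen_lt (by fun_prop) (by fun_prop)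
  have hUc : closedBall (0 : ℂ) 1 ⊆ U := fun z hz => by
    have hz1 : ‖z‖ ≤ 1 := by simpa using hz
    have h0 := norm_pos_iff.2 (one_sub_conj_mul_ne_zero_of_le ha' hz1)
    have h1 := norm_sq_one_sub_conj_mul (-a) z
    have h2 := (one_sub_norm_sq_pos ha').le
    have h3 : 0 ≤ 1 - ‖z‖ ^ 2 := by have := norm_nonneg z; nlinarith
    have h4 : ‖z - -a‖ ≤ ‖1 - conj (-a) * z‖ := by
      refine abs_le_of_sq_le_sq' ?_ h0.le |>.2
      nlinarith [mul_nonneg h2 h3]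
    change R * ‖z - -a‖ < ‖1 - conj (-a) * z‖
    have := norm_nonneg (z - -a)
    nlinarith
  obtain ⟨δ, hδ, hδU⟩ := (isCompact_closedBall (0 : ℂ) 1).exists_thickening_subset_open hUo hUc
  rw [thickening_closedBall hδ zero_le_one] at hδU
  have hρ : 1 < δ + 1 := by linarith
  have hTm : ∀ z ∈ ball (0 : ℂ) (δ + 1), (R : ℂ) * discAut (-a) z ∈ unitDisc := fun z hz => by
    have h1 : R * ‖z - -a‖ < ‖1 - conj (-a) * z‖ := hδU hz
    have h2 : 0 < ‖1 - conj (-a) * z‖ := lt_of_le_of_lt (by positivity) h1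
    change ‖(R : ℂ) * discAut (-a) z‖ < 1
    rwa [hRn, discAut, norm_div, ← mul_div_assoc, div_lt_one h2]
  have hne : ∀ z ∈ ball (0 : ℂ) (δ + 1), 1 - conj (-a) * z ≠ 0 := fun z hz => by
    have h1 : R * ‖z - -a‖ < ‖1 - conj (-a) * z‖ := hδU hz
    exact norm_pos_iff.1 (lt_of_le_of_lt (by positivity) h1)
  set G : ℂ → ℂ := fun z => F (R * discAut (-a) z) with hG
  have hGd : DifferentiableOn ℂ G (ball 0 (δ + 1)) := fun z hz =>
    ((hF.differentiableAt (hopen.mem_nhds (hTm z hz))).hasDerivAt.comp z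
      ((hasDerivAt_discAut (hne z hz)).const_mul _)).differentiableAt.differentiableWithinAt
  have hG1 : ∀ z ∈ ball (0 : ℂ) (δ + 1), ‖G z‖ < 1 := fun z hz => hmap _ (hTm z hz)
  have hG0 : G 0 = F (R * a) := by simp [hG, discAut_zero]
  have hmain := lintegral_logDefect_sub_le hρ hη hGd hG1
  have hpot := lintegral_hypDensity_comp_le hF hR0 hR ha
  rw [hG0] at hmain
  set K : ℂ → ℝ := fun w => |logDefect (F (R * w)) - logDefect (F (R * a))| with hK
  have hsph : ∀ w ∈ sphere (0 : ℂ) 1, (R : ℂ) * w ∈ unitDisc := fun w hw => by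
    change ‖(R : ℂ) * w‖ < 1
    rw [hRn, mem_sphere_zero_iff_norm.1 hw, mul_one]
    exact hR
  have hKc : ContinuousOn K (sphere 0 1) := by
    refine ((continuousOn_logDefect.comp (hF.continuousOn.comp (by fun_prop) hsph)
      fun w hw => hmap _ (hsph w hw)).sub continuousOn_const).abs
  have hcp := continuous_discKernel_circlePt ha
  have hKcp : Continuous fun θ => K (circlePt θ) :=
    hKc.comp_continuous continuous_circlePt fun θ => by simp
  have hKT : Continuous fun θ => K (discAut (-a) (circlePt θ)) := by
    refine hKc.comp_continuous ?_ fun θ => by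
      simpa using norm_discAut_of_norm_eq_one ha' (norm_circlePt θ)
    have := continuous_circlePt
    unfold discAut
    exact Continuous.div (by fun_prop) (by fun_prop) fun θ =>
      one_sub_conj_mul_ne_zero_of_le ha' (by simp)
  have hch := integral_circle_discAut ha hKc
  have hL : ∫⁻ θ in Ioc 0 (2 * π), ENNReal.ofReal (K (circlePt θ) * discKernel a (circlePt θ)) =
      ∫⁻ θ in Ioc 0 (2 * π), ENNReal.ofReal (K (discAut (-a) (circlePt θ))) := by
    rw [intervalIntegral.integral_of_le hpos.le, intervalIntegral.integral_of_le hpos.le] at hch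
    have hintble : IntegrableOn (fun θ => K (circlePt θ) * discKernel a (circlePt θ))
        (Ioc 0 (2 * π)) := (hKcp.mul hcp).integrableOn_Ioc
    rw [← ofReal_integral_eq_lintegral_ofReal hintble
      (Eventually.of_forall fun θ => mul_nonneg (abs_nonneg _)
        (discKernel_pos ha (by simp)).le), hch,
      ofReal_integral_eq_lintegral_ofReal hKT.integrableOn_Ioc
      (Eventually.of_forall fun θ => abs_nonneg _)]
  change ∫⁻ θ in Ioc 0 (2 * π), ENNReal.ofReal (K (circlePt θ) * discKernel a (circlePt θ)) ≤ _
  rw [hL]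
  refine hmain.trans ?_
  gcongr

end DiscAutomorphism

section CarlesonEstimate

open Complex Metric
open scoped Real ENNReal ComplexConjugate

lemma circlePt_add (x y : ℝ) : circlePt (x + y) = circlePt x * circlePt y := by
  unfold circlePt
  rw [← Complex.exp_add]
  push_cast
  ring_nf

lemma norm_mul_circlePt_arg (w : ℂ) : (‖w‖ : ℂ) * circlePt (arg w) = w :=
  Complex.norm_mul_exp_arg_mul_I w

lemma conj_circlePt (x : ℝ) : conj (circlePt x) = circlePt (-x) := by
  unfold circlePt
  rw [← Complex.exp_conj]
  simp

lemma exists_angle_near (w : ℂ) (θ₀ : ℝ) :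
    ∃ θ : ℝ, |θ - θ₀| ≤ π ∧ w = (‖w‖ : ℂ) * circlePt θ := by
  refine ⟨arg (w * circlePt (-θ₀)) + θ₀, by simpa using Complex.abs_arg_le_pi _, ?_⟩
  have h := norm_mul_circlePt_arg (w * circlePt (-θ₀))
  rw [norm_mul, norm_circlePt, mul_one] at h
  rw [circlePt_add, ← mul_assoc, h, mul_assoc, ← circlePt_add, neg_add_cancel]
  simp [circlePt]

lemma norm_sq_one_sub_mul_circlePt (r ψ : ℝ) :
    ‖1 - (r : ℂ) * circlePt ψ‖ ^ 2 = 1 - 2 * r * Real.cos ψ + r ^ 2 := by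
  have h : circlePt ψ = ⟨Real.cos ψ, Real.sin ψ⟩ := by
    apply Complex.ext
    · simp [circlePt, Complex.exp_ofReal_mul_I_re]
    · simp [circlePt, Complex.exp_ofReal_mul_I_im]
  rw [h, Complex.sq_norm, Complex.normSq_apply]
  simp only [Complex.sub_re, Complex.sub_im, Complex.mul_re, Complex.mul_im, Complex.one_re,
    Complex.one_im, Complex.ofReal_re, Complex.ofReal_im]
  nlinarith [Real.sin_sq_add_cos_sq ψ]

/-- On the unit disc the kernel is dominated by a weighted sum of indicators of Carleson squares. -/
lemma discKernel_le_of_dyadic {t θ₀ : ℝ} (ht : 0 < t) (ht1 : t ≤ 1) {w : ℂ} (hw : ‖w‖ < 1) :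
    ∃ k : ℕ, w ∈ carlesonSquare θ₀ (min 1 (2 ^ k * t)) ∧
      discKernel (((1 - t : ℝ) : ℂ) * circlePt θ₀) w ≤ 16 / (4 ^ k * t) := by
  obtain ⟨θ, hθ, hwθ⟩ := exists_angle_near w θ₀
  have hw0 := norm_nonneg w
  set x := |θ - θ₀| / π with hx
  have hpi := Real.pi_pos
  have hx0 : 0 ≤ x := by positivity
  have hx1 : x ≤ 1 := by rw [hx, div_le_one hpi]; exact hθ
  set d := max (1 - ‖w‖) x with hd
  have hd1 : d ≤ 1 := max_le (by linarith) hx1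
  have hd0 : 0 < d := lt_max_of_lt_left (by linarith)
  have hmem : ∀ s, d ≤ s → w ∈ carlesonSquare θ₀ s := fun s hs =>
    ⟨hw, by have := le_max_left (1 - ‖w‖) x; linarith, θ, by
      have h1 : x ≤ s := (le_max_right _ _).trans hs
      rw [hx, div_le_iff₀ hpi] at h1
      linarith, hwθ⟩
  set r := (1 - t) * ‖w‖ with hr
  have hr0 : 0 ≤ r := mul_nonneg (by linarith) hw0
  have hr1 : r ≤ ‖w‖ := by nlinarith
  have hrt : r ≤ 1 - t := by nlinarith
  have hb : ‖((1 - t : ℝ) : ℂ) * circlePt θ₀‖ = 1 - t := by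
    rw [norm_mul, norm_circlePt, mul_one, Complex.norm_real, Real.norm_of_nonneg (by linarith)]
  have hker : discKernel (((1 - t : ℝ) : ℂ) * circlePt θ₀) w =
      (1 - (1 - t) ^ 2) / (1 - 2 * r * Real.cos (θ - θ₀) + r ^ 2) := by
    rw [discKernel, hb, ← norm_sq_one_sub_mul_circlePt]
    congr 4
    rw [map_mul, conj_circlePt, Complex.conj_ofReal, hwθ, sub_eq_add_neg θ, circlePt_add]
    simp only [hr]
    push_cast
    ring
  have hcos : Real.cos (θ - θ₀) ≤ 1 - 2 * x ^ 2 := by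
    have := Real.cos_le_one_sub_mul_cos_sq hθ
    have e : x ^ 2 = (θ - θ₀) ^ 2 / π ^ 2 := by rw [hx, div_pow, sq_abs]
    rw [e]
    calc _ ≤ _ := this
      _ = _ := by ring
  have hden : (1 - r) ^ 2 + 4 * r * x ^ 2 ≤ 1 - 2 * r * Real.cos (θ - θ₀) + r ^ 2 := by
    nlinarith
  have hnum : 1 - (1 - t) ^ 2 ≤ 2 * t := by nlinarith
  have hnum0 : 0 ≤ 1 - (1 - t) ^ 2 := by nlinarith
  have hrx : 0 ≤ r * x ^ 2 := by positivity
  rcases le_or_gt d t with hdt | hdt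
  · refine ⟨0, hmem _ (by simp [hd1, hdt]), ?_⟩
    rw [hker, pow_zero, one_mul]
    have h1 : t ^ 2 ≤ 1 - 2 * r * Real.cos (θ - θ₀) + r ^ 2 := by nlinarith
    calc _ ≤ 2 * t / t ^ 2 := by gcongr
      _ = 2 / t := by field_simp
      _ ≤ 16 / t := by gcongr; norm_num
  · have hex : ∃ k : ℕ, d ≤ 2 ^ k * t := by
      obtain ⟨k, hk⟩ := pow_unbounded_of_one_lt (d / t) (one_lt_two)
      exact ⟨k, ((div_lt_iff₀ ht).1 hk).le⟩
    classical
    set k := Nat.find hex with hk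
    have hk1 : d ≤ 2 ^ k * t := Nat.find_spec hex
    have hk0 : k ≠ 0 := fun h => by
      rw [h] at hk1
      linarith
    obtain ⟨j, hj⟩ := Nat.exists_eq_succ_of_ne_zero hk0
    have hj1 : 2 ^ j * t < d := not_le.1 (Nat.find_min hex (by omega))
    refine ⟨k, hmem _ (le_min hd1 hk1), ?_⟩
    have hdd : d ^ 2 / 2 ≤ 1 - 2 * r * Real.cos (θ - θ₀) + r ^ 2 := by
      refine le_trans ?_ hden
      rcases max_choice (1 - ‖w‖) x with h | h
      · rw [hd, h]
        nlinarith
      · rw [hd, h]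
        rcases le_or_gt (1 / 4) r with h4 | h4
        · nlinarith [sq_nonneg x]
        · nlinarith
    have hj0 : 0 < 2 ^ j * t := by positivity
    rw [hker, hj]
    calc _ ≤ 2 * t / (d ^ 2 / 2) := by gcongr
      _ ≤ 2 * t / ((2 ^ j * t) ^ 2 / 2) := by gcongr
      _ = _ := by
        have : (4 : ℝ) ^ j.succ = 4 * (2 ^ j) ^ 2 := by
          rw [pow_succ, ← pow_mul, mul_comm j 2, pow_mul]; norm_num [mul_comm]
        rw [this]
        field_simp
        norm_num

lemma lintegral_discKernel_le {μ : Measure ℂ} (hμ : ∀ᵐ w ∂μ, w ∈ unitDisc) {A t θ₀ : ℝ}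
    (hA : 0 ≤ A) (ht : 0 < t) (ht1 : t ≤ 1)
    (h : ∀ k : ℕ, μ (carlesonSquare θ₀ (min 1 (2 ^ k * t))) ≤ ENNReal.ofReal (A * 3 ^ k * t)) :
    ∫⁻ w, ENNReal.ofReal (discKernel (((1 - t : ℝ) : ℂ) * circlePt θ₀) w) ∂μ ≤
      ENNReal.ofReal (64 * A) := by
  set Q : ℕ → Set ℂ := fun k => toMeasurable μ (carlesonSquare θ₀ (min 1 (2 ^ k * t))) with hQ
  have hQm : ∀ k, MeasurableSet (Q k) := fun k => measurableSet_toMeasurable _ _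
  have hs : HasSum (fun k : ℕ => 16 * A * (3 / 4 : ℝ) ^ k) (16 * A * (1 - 3 / 4)⁻¹) :=
    (hasSum_geometric_of_lt_one (by norm_num) (by norm_num)).mul_left _
  calc ∫⁻ w, ENNReal.ofReal (discKernel (((1 - t : ℝ) : ℂ) * circlePt θ₀) w) ∂μ
      ≤ ∫⁻ w, ∑' k : ℕ, ENNReal.ofReal (16 / (4 ^ k * t)) * (Q k).indicator 1 w ∂μ := by
        refine lintegral_mono_ae ?_
        filter_upwards [hμ] with w hw
        obtain ⟨k, hk, hle⟩ := discKernel_le_of_dyadic (θ₀ := θ₀) ht ht1 hw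
        refine le_trans ?_ (ENNReal.le_tsum k)
        rw [indicator_of_mem (subset_toMeasurable _ _ hk), Pi.one_apply, mul_one]
        exact ENNReal.ofReal_le_ofReal hle
    _ = ∑' k : ℕ, ENNReal.ofReal (16 / (4 ^ k * t)) *
          μ (carlesonSquare θ₀ (min 1 (2 ^ k * t))) := by
        rw [lintegral_tsum fun k =>
          ((measurable_one.indicator (hQm k)).const_mul _).aemeasurable]
        refine tsum_congr fun k => ?_
        rw [lintegral_const_mul _ (measurable_one.indicator (hQm k)),
          lintegral_indicator_one (hQm k), hQ, measure_toMeasurable]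
    _ ≤ ∑' k : ℕ, ENNReal.ofReal (16 * A * (3 / 4 : ℝ) ^ k) := by
        refine ENNReal.tsum_le_tsum fun k => ?_
        calc _ ≤ ENNReal.ofReal (16 / (4 ^ k * t)) * ENNReal.ofReal (A * 3 ^ k * t) := by
              gcongr; exact h k
          _ = _ := by
              rw [← ENNReal.ofReal_mul (by positivity)]
              congr 1
              rw [div_pow]
              field_simp
    _ = ENNReal.ofReal (64 * A) := by
        rw [← ENNReal.ofReal_tsum_of_nonneg (fun k => by positivity) hs.summable, hs.tsum_eq]
        congr 1
        ring

lemma aemeasurable_hypDensity {F : ℂ → ℂ} (hF : DifferentiableOn ℂ F unitDisc) :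
    AEMeasurable (hypDensity F) (volume.restrict unitDisc) := by
  have hms : MeasurableSet unitDisc := by rw [unitDisc_eq_ball]; exact measurableSet_ball
  have h1 : AEMeasurable F (volume.restrict unitDisc) := hF.continuousOn.aemeasurable hms
  have h2 := measurable_deriv F
  unfold hypDensity
  fun_prop

lemma hypPotential_eq {F : ℂ → ℂ} (hF : DifferentiableOn ℂ F unitDisc) (b : ℂ) :
    hypPotential F b = ∫⁻ w, ENNReal.ofReal (discKernel b w)
      ∂((volume.restrict unitDisc).withDensity (hypDensity F)) := by
  have hm : Measurable fun w => ENNReal.ofReal (discKernel b w) := by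
    unfold discKernel
    fun_prop
  rw [lintegral_withDensity_eq_lintegral_mul₀ (aemeasurable_hypDensity hF) hm.aemeasurable]
  rfl

lemma ae_mem_unitDisc_withDensity (g : ℂ → ℝ≥0∞) :
    ∀ᵐ w ∂((volume.restrict unitDisc).withDensity g), w ∈ unitDisc := by
  have hms : MeasurableSet unitDisc := by rw [unitDisc_eq_ball]; exact measurableSet_ball
  exact (withDensity_absolutelyContinuous _ _).ae_le (ae_restrict_mem hms)

lemma eq_one_sub_mul_circlePt (b : ℂ) :
    b = ((1 - (1 - ‖b‖) : ℝ) : ℂ) * circlePt (arg b) := by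
  rw [sub_sub_cancel, norm_mul_circlePt_arg]

lemma exists_hypPotential_le {F : ℂ → ℂ} (hF : DifferentiableOn ℂ F unitDisc)
    (hcar : IsCarleson ((volume.restrict unitDisc).withDensity (hypDensity F))) :
    ∃ C : ℝ, 0 < C ∧ ∀ b : ℂ, ‖b‖ < 1 → hypPotential F b ≤ ENNReal.ofReal C := by
  obtain ⟨C, hC, h⟩ := hcar
  refine ⟨64 * C, by positivity, fun b hb => ?_⟩
  have ht : 0 < 1 - ‖b‖ := by linarith
  have ht1 : 1 - ‖b‖ ≤ 1 := by linarith [norm_nonneg b]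
  rw [hypPotential_eq hF, eq_one_sub_mul_circlePt b]
  refine lintegral_discKernel_le (ae_mem_unitDisc_withDensity _) hC.le ht ht1 fun k => ?_
  refine (h _ _ (lt_min one_pos (by positivity)) (min_le_left _ _)).trans ?_
  refine ENNReal.ofReal_le_ofReal ?_
  have h23 : (2 : ℝ) ^ k ≤ 3 ^ k := by gcongr; norm_num
  calc C * min 1 (2 ^ k * (1 - ‖b‖)) ≤ C * (2 ^ k * (1 - ‖b‖)) := by
        gcongr; exact min_le_right _ _
    _ ≤ C * (3 ^ k * (1 - ‖b‖)) := by gcongr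
    _ = _ := by ring

lemma exists_hypPotential_le_of_vanishing {F : ℂ → ℂ} (hF : DifferentiableOn ℂ F unitDisc)
    (hcar : IsVanishingCarleson ((volume.restrict unitDisc).withDensity (hypDensity F)))
    {ε : ℝ} (hε : 0 < ε) :
    ∃ δ : ℝ, 0 < δ ∧ δ < 1 ∧ ∀ b : ℂ, 1 - δ ≤ ‖b‖ → ‖b‖ < 1 →
      hypPotential F b ≤ ENNReal.ofReal ε := by
  obtain ⟨⟨C, hC, h⟩, hv⟩ := hcar
  set ε' := ε / 64 with hε'
  have hε'0 : 0 < ε' := by positivity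
  obtain ⟨δ, hδ, hvδ⟩ := hv ε' hε'0
  obtain ⟨N, hN⟩ := exists_pow_lt_of_lt_one (show 0 < ε' / C by positivity)
    (show (2 / 3 : ℝ) < 1 by norm_num)
  rw [lt_div_iff₀ hC] at hN
  refine ⟨min (1 / 2) (δ / 2 ^ (N + 1)), lt_min (by norm_num) (by positivity),
    (min_le_left _ _).trans_lt (by norm_num), fun b hb1 hb => ?_⟩
  have ht : 0 < 1 - ‖b‖ := by linarith
  have ht1 : 1 - ‖b‖ ≤ 1 := by linarith [norm_nonneg b]
  have htδ : 1 - ‖b‖ ≤ δ / 2 ^ (N + 1) := by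
    have := min_le_right (1 / 2) (δ / 2 ^ (N + 1))
    linarith
  rw [le_div_iff₀ (by positivity), pow_succ] at htδ
  rw [hypPotential_eq hF, eq_one_sub_mul_circlePt b, show ε = 64 * ε' by rw [hε']; ring]
  refine lintegral_discKernel_le (ae_mem_unitDisc_withDensity _) hε'0.le ht ht1 fun k => ?_
  have hpos : 0 < min 1 (2 ^ k * (1 - ‖b‖)) := lt_min one_pos (by positivity)
  have h23 : (2 : ℝ) ^ k ≤ 3 ^ k := by gcongr; norm_num
  rcases lt_or_ge (2 ^ k * (1 - ‖b‖)) δ with hk | hk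
  · refine (hvδ _ _ hpos ((min_le_right _ _).trans_lt hk)).trans (ENNReal.ofReal_le_ofReal ?_)
    calc ε' * min 1 (2 ^ k * (1 - ‖b‖)) ≤ ε' * (2 ^ k * (1 - ‖b‖)) := by
          gcongr; exact min_le_right _ _
      _ ≤ ε' * (3 ^ k * (1 - ‖b‖)) := by gcongr
      _ = _ := by ring
  · refine (h _ _ hpos (min_le_left _ _)).trans (ENNReal.ofReal_le_ofReal ?_)
    have hNk : N ≤ k := by
      by_contra hlt
      have : (2 : ℝ) ^ k ≤ 2 ^ N := pow_le_pow_right₀ one_le_two (by omega)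
      have h2N : (0 : ℝ) < 2 ^ N := by positivity
      nlinarith
    have hpw : (2 : ℝ) ^ k * C ≤ ε' * 3 ^ k := by
      have e : (2 : ℝ) ^ k = (2 / 3) ^ k * 3 ^ k := by rw [← mul_pow]; norm_num
      have e2 : (2 / 3 : ℝ) ^ k ≤ (2 / 3) ^ N :=
        pow_le_pow_of_le_one (by norm_num) (by norm_num) hNk
      calc (2 : ℝ) ^ k * C = (2 / 3) ^ k * C * 3 ^ k := by rw [e]; ring
        _ ≤ (2 / 3) ^ N * C * 3 ^ k := by gcongr
        _ ≤ _ := by gcongr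
    calc C * min 1 (2 ^ k * (1 - ‖b‖)) ≤ C * (2 ^ k * (1 - ‖b‖)) := by
          gcongr; exact min_le_right _ _
      _ = (2 ^ k * C) * (1 - ‖b‖) := by ring
      _ ≤ (ε' * 3 ^ k) * (1 - ‖b‖) := by gcongr
      _ = _ := by ring

end CarlesonEstimate

section RadialLimits

open Complex Metric
open scoped Real ENNReal ComplexConjugate NNReal

lemma circleIntegral_sub_sq_inv_mul {f : ℂ → ℂ} {z : ℂ} (hf : DiffContOnCl ℂ f (ball 0 1))
    (hz : z ∈ ball (0 : ℂ) 1) :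
    ∮ w in C(0, 1), ((w - z) ^ 2)⁻¹ * f w = 2 * π * I * deriv f z := by
  have hnhds : ball (0 : ℂ) 1 ∈ 𝓝 z := isOpen_ball.mem_nhds hz
  have hnhds' : closedBall (0 : ℂ) 1 ∈ 𝓝 z := mem_of_superset hnhds ball_subset_closedBall
  have hd : DiffContOnCl ℂ (dslope f z) (ball 0 1) := by
    refine ⟨(differentiableOn_dslope hnhds).2 hf.differentiableOn, ?_⟩
    rw [closure_ball _ one_ne_zero]
    exact (continuousOn_dslope hnhds').2
      ⟨hf.continuousOn_ball, hf.differentiableAt isOpen_ball hz⟩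
  have h1 := hd.circleIntegral_sub_inv_smul hz
  have h2 : ∮ w in C(0, 1), (w - z) ^ (-2 : ℤ) = 0 :=
    circleIntegral.integral_sub_zpow_of_ne (by norm_num) 0 z 1
  have hne : ∀ w ∈ sphere (0 : ℂ) 1, w - z ≠ 0 := by
    intro w hw h
    rw [sub_eq_zero.1 h] at hw
    simp only [mem_sphere_iff_norm, sub_zero, mem_ball_zero_iff] at hw hz
    linarith
  have h3 : ∮ w in C(0, 1), ((w - z) ^ 2)⁻¹ * f w =
      ∮ w in C(0, 1), ((w - z)⁻¹ • dslope f z w + f z • (w - z) ^ (-2 : ℤ)) := by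
    refine circleIntegral.integral_congr zero_le_one fun w hw => ?_
    have hw0 := hne w hw
    have hwz : w ≠ z := fun h => hw0 (by rw [h, sub_self])
    simp only [smul_eq_mul, dslope_of_ne _ hwz, slope, vsub_eq_sub]
    rw [zpow_neg]
    norm_cast
    field_simp
    ring
  have hs : ContinuousOn (fun w : ℂ => w - z) (sphere 0 1) := by fun_prop
  have hc1 : ContinuousOn (fun w => (w - z)⁻¹ • dslope f z w) (sphere 0 1) := by
    refine ContinuousOn.smul (hs.inv₀ hne) ?_
    exact hd.continuousOn_ball.mono sphere_subset_closedBall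
  have hc2 : ContinuousOn (fun w => f z • (w - z) ^ (-2 : ℤ)) (sphere 0 1) := by
    have := hs.zpow₀ (-2) fun w hw => Or.inl (hne w hw)
    exact this.const_smul (f z)
  rw [h3, circleIntegral.integral_add (hc1.circleIntegrable zero_le_one)
    (hc2.circleIntegrable zero_le_one), h1, circleIntegral.integral_smul, h2]
  simp [dslope_same]

lemma circleIntegral_sub_sq_inv_mul_eq_zero {f : ℂ → ℂ} {z : ℂ}
    (hf : DiffContOnCl ℂ f (ball 0 1)) (hz : 1 < ‖z‖) :
    ∮ w in C(0, 1), ((w - z) ^ 2)⁻¹ * f w = 0 := by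
  refine DiffContOnCl.circleIntegral_eq_zero zero_le_one ?_
  have hne : ∀ w ∈ closure (ball (0 : ℂ) 1), (w - z) ^ 2 ≠ 0 := by
    intro w hw h
    rw [closure_ball _ one_ne_zero, mem_closedBall_zero_iff] at hw
    rw [sub_eq_zero.1 (pow_eq_zero_iff two_ne_zero |>.1 h)] at hw
    linarith
  have h : DiffContOnCl ℂ (fun w => (w - z) ^ 2) (ball 0 1) :=
    Differentiable.diffContOnCl (by fun_prop)
  exact (h.inv hne).smul hf

lemma norm_sub_sq_inv_sub_le {r : ℝ} (hr0 : 0 < r) (hr1 : r < 1) {w ζ : ℂ} (hw : ‖w‖ = 1)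
    (hζ : ‖ζ‖ = 1) :
    ‖((w - r * ζ) ^ 2)⁻¹ - ((w - ζ / r) ^ 2)⁻¹‖ ≤ 2 * (1 - r ^ 2) / ‖w - r * ζ‖ ^ 3 := by
  have hrc : (r : ℂ) ≠ 0 := by exact_mod_cast hr0.ne'
  have hsymm : ‖w - r * ζ‖ = ‖r * w - ζ‖ := by
    rw [← sq_eq_sq₀ (norm_nonneg _) (norm_nonneg _), ← normSq_eq_norm_sq, ← normSq_eq_norm_sq,
      normSq_sub, normSq_sub, normSq_eq_norm_sq, normSq_eq_norm_sq, normSq_eq_norm_sq,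
      normSq_eq_norm_sq]
    simp only [norm_mul, hw, hζ, map_mul, conj_ofReal, norm_real]
    rw [show w * (r * conj ζ) = r * w * conj ζ by ring]
    ring
  set d := ‖w - r * ζ‖ with hd
  have hd0 : 0 < d := by
    have h1 : ‖w‖ ≤ d + ‖(r : ℂ) * ζ‖ := by
      simpa using norm_add_le (w - r * ζ) (r * ζ)
    rw [norm_mul, hζ, hw, norm_real, Real.norm_of_nonneg hr0.le] at h1
    linarith
  have hA : w - r * ζ ≠ 0 := norm_pos_iff.1 hd0
  have hBn : ‖w - ζ / r‖ = d / r := by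
    have : w - ζ / r = (r * w - ζ) / r := by field_simp
    rw [this, norm_div, ← hsymm, norm_real, Real.norm_of_nonneg hr0.le]
  have hB : w - ζ / r ≠ 0 := norm_pos_iff.1 (by rw [hBn]; positivity)
  have e : ((w - r * ζ) ^ 2)⁻¹ - ((w - ζ / r) ^ 2)⁻¹ =
      ((r * ζ - ζ / r) * ((w - r * ζ) + (w - ζ / r))) /
        ((w - r * ζ) ^ 2 * (w - ζ / r) ^ 2) := by
    rw [inv_sub_inv (pow_ne_zero 2 hA) (pow_ne_zero 2 hB)]
    ring
  have h1 : ‖(r : ℂ) * ζ - ζ / r‖ = (1 - r ^ 2) / r := by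
    have : (r : ℂ) * ζ - ζ / r = -(((1 - r ^ 2) / r : ℝ) : ℂ) * ζ := by
      push_cast
      field_simp
      ring
    rw [this, norm_mul, norm_neg, norm_real, hζ, mul_one, Real.norm_of_nonneg]
    exact div_nonneg (by nlinarith) hr0.le
  have h2 : ‖(w - r * ζ) + (w - ζ / r)‖ ≤ d + d / r := by
    rw [← hBn]; exact norm_add_le _ _
  rw [e, norm_div, norm_mul, norm_mul, norm_pow, norm_pow, h1, hBn, ← hd]
  have h3 : (1 - r ^ 2) / r * ‖(w - r * ζ) + (w - ζ / r)‖ ≤ (1 - r ^ 2) / r * (d + d / r) :=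
    mul_le_mul_of_nonneg_left h2 (div_nonneg (by nlinarith) hr0.le)
  calc _ ≤ (1 - r ^ 2) / r * (d + d / r) / (d ^ 2 * (d / r) ^ 2) := by gcongr
    _ = (1 + r) * (1 - r ^ 2) / d ^ 3 := by field_simp; ring
    _ ≤ _ := by
      gcongr
      · nlinarith
      · linarith

lemma norm_circlePt_sub_ge {x y : ℝ} (h : |x - y| ≤ π) :
    2 / π * |x - y| ≤ ‖circlePt x - circlePt y‖ := by
  have h1 : ‖circlePt x - circlePt y‖ ^ 2 = 2 - 2 * Real.cos (x - y) := by
    have e : circlePt x - circlePt y = -(circlePt y * (1 - ((1 : ℝ) : ℂ) * circlePt (x - y))) := by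
      rw [ofReal_one, one_mul, mul_sub, ← circlePt_add]
      ring_nf
    rw [e, norm_neg, norm_mul, norm_circlePt, one_mul, norm_sq_one_sub_mul_circlePt]
    ring
  refine abs_le_of_sq_le_sq' ?_ (norm_nonneg _) |>.2
  rw [h1, mul_pow, sq_abs]
  have h2 := Real.cos_le_one_sub_mul_cos_sq h
  have : (2 / π) ^ 2 * (x - y) ^ 2 = 2 * (2 / π ^ 2 * (x - y) ^ 2) := by ring
  linarith

/-- A function with vanishing derivative on the circle at a point is dominated by a small linear
term plus a cubic term. -/
lemma exists_le_linear_add_cubic {h : ℂ → ℂ} (hc : Continuous h) {θ₀ : ℝ}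
    (h0 : h (circlePt θ₀) = 0) (hd : HasDerivAt (fun θ => h (circlePt θ)) 0 θ₀) {ε : ℝ}
    (hε : 0 < ε) :
    ∃ M : ℝ, 0 ≤ M ∧ ∀ θ, ‖h (circlePt θ)‖ ≤
      ε * ‖circlePt θ - circlePt θ₀‖ + M * ‖circlePt θ - circlePt θ₀‖ ^ 3 := by
  obtain ⟨B, hB⟩ := (isCompact_sphere (0 : ℂ) 1).exists_bound_of_continuousOn hc.continuousOn
  have hB' : ∀ θ, ‖h (circlePt θ)‖ ≤ B := fun θ => hB _ (by simp)
  have hB0 : 0 ≤ B := (norm_nonneg _).trans (hB' 0)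
  rw [hasDerivAt_iff_isLittleO] at hd
  have hd' := hd.def (c := ε * (2 / π)) (by positivity)
  simp only [h0, sub_zero, smul_zero] at hd'
  obtain ⟨η, hη, hnear⟩ := Metric.eventually_nhds_iff.1 hd'
  refine ⟨B / (2 / π * η) ^ 3, by positivity, fun θ => ?_⟩
  obtain ⟨φ, hφ, hφe⟩ := exists_angle_near (circlePt θ) θ₀
  rw [norm_circlePt, ofReal_one, one_mul] at hφe
  rw [hφe]
  have hge := norm_circlePt_sub_ge hφ
  have h3 : 0 ≤ B / (2 / π * η) ^ 3 * ‖circlePt φ - circlePt θ₀‖ ^ 3 := by positivity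
  rcases lt_or_ge |φ - θ₀| η with hlt | hge'
  · have := hnear (by rwa [Real.dist_eq])
    rw [Real.norm_eq_abs] at this
    calc _ ≤ _ := this
      _ = ε * (2 / π * |φ - θ₀|) := by ring
      _ ≤ ε * ‖circlePt φ - circlePt θ₀‖ := by gcongr
      _ ≤ _ := by linarith
  · have h4 : 2 / π * η ≤ ‖circlePt φ - circlePt θ₀‖ :=
      (mul_le_mul_of_nonneg_left hge' (by positivity)).trans hge
    calc _ ≤ B := hB' _
      _ = B / (2 / π * η) ^ 3 * (2 / π * η) ^ 3 := by field_simp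
      _ ≤ B / (2 / π * η) ^ 3 * ‖circlePt φ - circlePt θ₀‖ ^ 3 := by gcongr
      _ ≤ _ := by
        have : 0 ≤ ε * ‖circlePt φ - circlePt θ₀‖ := by positivity
        linarith

lemma norm_deriv_le_of_le_linear_add_cubic {h : ℂ → ℂ} (hh : DiffContOnCl ℂ h (ball 0 1))
    {θ₀ ε M : ℝ} (hε : 0 ≤ ε) (hM : 0 ≤ M)
    (hbd : ∀ θ, ‖h (circlePt θ)‖ ≤
      ε * ‖circlePt θ - circlePt θ₀‖ + M * ‖circlePt θ - circlePt θ₀‖ ^ 3)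
    {r : ℝ} (hr0 : 0 < r) (hr1 : r < 1) :
    ‖deriv h (r * circlePt θ₀)‖ ≤ 4 * ε + 16 * M * (1 - r ^ 2) := by
  set ζ := circlePt θ₀ with hζ
  have hζ1 : ‖ζ‖ = 1 := norm_circlePt _
  have hzn : ‖(r : ℂ) * ζ‖ = r := by
    rw [norm_mul, hζ1, norm_real, Real.norm_of_nonneg hr0.le, mul_one]
  have hz : (r : ℂ) * ζ ∈ ball (0 : ℂ) 1 := by
    rwa [mem_ball_zero_iff, hzn]
  have hz' : 1 < ‖ζ / (r : ℂ)‖ := by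
    rw [norm_div, hζ1, norm_real, Real.norm_of_nonneg hr0.le]
    exact (one_lt_div hr0).2 hr1
  have hrr : 0 ≤ 1 - r ^ 2 := by nlinarith
  have hne : ∀ z : ℂ, ‖z‖ ≠ 1 → ∀ w ∈ sphere (0 : ℂ) 1, (w - z) ^ 2 ≠ 0 := by
    intro z hz w hw h
    rw [sub_eq_zero.1 (pow_eq_zero_iff two_ne_zero |>.1 h)] at hw
    exact hz (by simpa using hw)
  have hhc : ContinuousOn h (sphere 0 1) := hh.continuousOn_ball.mono sphere_subset_closedBall
  have hintble : ∀ z : ℂ, ‖z‖ ≠ 1 → CircleIntegrable (fun w => ((w - z) ^ 2)⁻¹ * h w) 0 1 := by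
    intro z hz
    refine ContinuousOn.circleIntegrable zero_le_one ?_
    exact (ContinuousOn.inv₀ (by fun_prop) (hne z hz)).mul hhc
  have hI : ∮ w in C(0, 1), (((w - r * ζ) ^ 2)⁻¹ - ((w - ζ / r) ^ 2)⁻¹) * h w =
      2 * π * I * deriv h (r * ζ) := by
    simp only [sub_mul]
    rw [circleIntegral.integral_sub (hintble _ (by rw [hzn]; exact hr1.ne)) (hintble _ hz'.ne'),
      circleIntegral_sub_sq_inv_mul hh hz, circleIntegral_sub_sq_inv_mul_eq_zero hh hz', sub_zero]
  have hpt : ∀ θ, ‖(((circlePt θ - r * ζ) ^ 2)⁻¹ - ((circlePt θ - ζ / r) ^ 2)⁻¹) *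
      h (circlePt θ)‖ ≤ 4 * ε * discKernel (r * ζ) (circlePt θ) + 16 * M * (1 - r ^ 2) := by
    intro θ
    rw [norm_mul, discKernel_circlePt, hzn]
    set d := ‖circlePt θ - r * ζ‖ with hd
    have hdr : 1 - r ≤ d := by
      have h1 : ‖circlePt θ‖ ≤ d + ‖(r : ℂ) * ζ‖ := by
        simpa using norm_add_le (circlePt θ - r * ζ) (r * ζ)
      rw [hzn, norm_circlePt] at h1
      linarith
    have hd0 : 0 < d := by linarith
    have h2 : ‖circlePt θ - ζ‖ ≤ 2 * d := by
      have h3 : ‖circlePt θ - ζ‖ ≤ d + ‖(r : ℂ) * ζ - ζ‖ := by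
        simpa using norm_add_le (circlePt θ - r * ζ) (r * ζ - ζ)
      have h4 : ‖(r : ℂ) * ζ - ζ‖ = 1 - r := by
        rw [show (r : ℂ) * ζ - ζ = -((1 - r : ℝ) : ℂ) * ζ by push_cast; ring, norm_mul, norm_neg,
          norm_real, hζ1, mul_one, Real.norm_of_nonneg (by linarith)]
      linarith
    calc _ ≤ 2 * (1 - r ^ 2) / d ^ 3 * (ε * (2 * d) + M * (2 * d) ^ 3) := by
          refine mul_le_mul (norm_sub_sq_inv_sub_le hr0 hr1 (norm_circlePt _) hζ1)
            ((hbd θ).trans ?_) (norm_nonneg _) (by positivity)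
          gcongr
      _ = _ := by field_simp; ring
  have hnorm : ‖∮ w in C(0, 1), (((w - r * ζ) ^ 2)⁻¹ - ((w - ζ / r) ^ 2)⁻¹) * h w‖ ≤
      2 * π * (4 * ε + 16 * M * (1 - r ^ 2)) := by
    rw [circleIntegral]
    have hk : Continuous fun θ => discKernel (r * ζ) (circlePt θ) :=
      continuous_discKernel_circlePt (by rwa [hzn])
    calc _ ≤ ∫ θ in (0 : ℝ)..2 * π,
          (4 * ε * discKernel (r * ζ) (circlePt θ) + 16 * M * (1 - r ^ 2)) := by
          refine intervalIntegral.norm_integral_le_of_norm_le Real.two_pi_pos.le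
            (ae_of_all _ fun θ _ => ?_) (Continuous.intervalIntegrable (by fun_prop) _ _)
          rw [norm_smul, deriv_circleMap, circleMap_zero_one, norm_mul, norm_circlePt, norm_I,
            mul_one, one_mul]
          exact hpt θ
      _ = _ := by
          rw [intervalIntegral.integral_add (Continuous.intervalIntegrable (by fun_prop) _ _)
            (Continuous.intervalIntegrable (by fun_prop) _ _),
            intervalIntegral.integral_const_mul, integral_discKernel (by rwa [hzn])]
          simp
          ring
  rw [hI, norm_mul] at hnorm
  have e : ‖(2 * π * I : ℂ)‖ = 2 * π := by simp [Real.pi_pos.le]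
  rw [e] at hnorm
  exact le_of_mul_le_mul_left hnorm Real.two_pi_pos

/-- **Fatou's theorem** for bounded analytic functions. -/
theorem exists_radial_limit {F : ℂ → ℂ} (hF : DifferentiableOn ℂ F unitDisc)
    (hmap : ∀ z ∈ unitDisc, F z ∈ unitDisc) :
    ∀ᵐ θ : ℝ, ∃ c : ℂ, Tendsto (fun r : ℝ => F (r * circlePt θ)) (𝓝[<] 1) (𝓝 c) := by
  rw [unitDisc_eq_ball] at hF hmap
  obtain ⟨g₀, hg₀⟩ := hF.isExactOn_ball
  have hlip : LipschitzOnWith 1 g₀ (ball 0 1) := by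
    refine (convex_ball (0 : ℂ) 1).lipschitzOnWith_of_nnnorm_hasDerivWithin_le
      (fun x hx => (hg₀ x hx).hasDerivWithinAt) fun x hx => ?_
    have := hmap x hx
    rw [mem_ball_zero_iff] at this
    exact_mod_cast this.le
  obtain ⟨g, hg, hgeq⟩ := hlip.extend_finite_dimension
  have hgd : ∀ x ∈ ball (0 : ℂ) 1, HasDerivAt g (F x) x := fun x hx =>
    (hg₀ x hx).congr_of_eventuallyEq
      (eventually_of_mem (isOpen_ball.mem_nhds hx) fun y hy => (hgeq hy).symm)
  have hgc : DiffContOnCl ℂ g (ball 0 1) :=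
    ⟨fun x hx => (hgd x hx).differentiableAt.differentiableWithinAt, hg.continuous.continuousOn⟩
  have hcl : LipschitzWith 1 circlePt := by
    refine lipschitzWith_of_nnnorm_deriv_le (fun θ => (hasDerivAt_circlePt θ).differentiableAt)
      fun θ => ?_
    rw [(hasDerivAt_circlePt θ).deriv]
    simp [← NNReal.coe_le_coe]
  filter_upwards [(hg.comp hcl).ae_differentiableAt_real] with θ₀ hθ₀
  set D := deriv (g ∘ circlePt) θ₀ with hD
  set ζ := circlePt θ₀ with hζ
  have hζ0 : ζ ≠ 0 := norm_pos_iff.1 (by rw [hζ, norm_circlePt]; exact one_pos)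
  set c : ℂ := D / (I * ζ) with hc
  refine ⟨c, ?_⟩
  set h : ℂ → ℂ := fun w => g w - (g ζ + c * (w - ζ)) with hh
  have hhc : Continuous h := by have := hg.continuous; fun_prop
  have hhd : DiffContOnCl ℂ h (ball 0 1) :=
    hgc.sub (Differentiable.diffContOnCl (by fun_prop))
  have hhder : ∀ x ∈ ball (0 : ℂ) 1, deriv h x = F x - c := fun x hx => by
    have h1 : HasDerivAt (fun w : ℂ => g ζ + c * (w - ζ)) (c * 1) x :=
      (((hasDerivAt_id x).sub_const ζ).const_mul c).const_add (g ζ)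
    rw [mul_one] at h1
    exact ((hgd x hx).sub h1).deriv
  have hh0 : h ζ = 0 := by simp [hh]
  have hhθ : HasDerivAt (fun θ => h (circlePt θ)) 0 θ₀ := by
    have h1 : HasDerivAt (fun θ => g (circlePt θ)) D θ₀ := hθ₀.hasDerivAt
    have h2 : HasDerivAt (fun θ => g ζ + c * (circlePt θ - ζ)) (c * (I * ζ)) θ₀ :=
      (((hasDerivAt_circlePt θ₀).sub_const ζ).const_mul c).const_add (g ζ)
    have h3 := h1.sub h2
    rwa [hc, div_mul_cancel₀ _ (mul_ne_zero I_ne_zero hζ0), sub_self] at h3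
  rw [Metric.tendsto_nhds]
  intro ε hε
  obtain ⟨M, hM0, hM⟩ := exists_le_linear_add_cubic hhc hh0 hhθ (ε := ε / 8) (by positivity)
  have hlim : Tendsto (fun r : ℝ => 4 * (ε / 8) + 16 * M * (1 - r ^ 2)) (𝓝[<] 1)
      (𝓝 (4 * (ε / 8) + 16 * M * (1 - 1 ^ 2))) :=
    (Continuous.tendsto (by fun_prop) 1).mono_left nhdsWithin_le_nhds
  have hev := hlim.eventually_lt_const (u := ε) (by linarith)
  filter_upwards [hev, self_mem_nhdsWithin,
    mem_nhdsWithin_of_mem_nhds (Ioi_mem_nhds (zero_lt_one' ℝ))] with r hr hr1 hr0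
  have hmem : (r : ℂ) * ζ ∈ ball (0 : ℂ) 1 := by
    rw [mem_ball_zero_iff, norm_mul, hζ, norm_circlePt, norm_real,
      Real.norm_of_nonneg (le_of_lt hr0), mul_one]
    exact hr1
  have := norm_deriv_le_of_le_linear_add_cubic hhd (by positivity) hM0 hM hr0 hr1
  rw [hhder _ hmem] at this
  rw [dist_eq_norm]
  exact this.trans_lt hr

end RadialLimits

section VanishingOscillation

open Complex Metric
open scoped Real ENNReal ComplexConjugate

/-- The Poisson-weighted oscillation on the circle of radius `R` of `-log (1 - ‖F‖ ^ 2)`. -/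
def radialOsc (F : ℂ → ℂ) (R : ℝ) (a : ℂ) : ℝ≥0∞ :=
  ∫⁻ θ in Ioc 0 (2 * π), ENNReal.ofReal
    (|logDefect (F (R * circlePt θ)) - logDefect (F (R * a))| * discKernel a (circlePt θ))

lemma norm_ofReal_mul_lt_one {R : ℝ} (hR0 : 0 < R) (hR : R < 1) {a : ℂ} (ha : ‖a‖ ≤ 1) :
    ‖(R : ℂ) * a‖ < 1 := by
  rw [norm_mul, norm_real, Real.norm_of_nonneg hR0.le]
  nlinarith [norm_nonneg a]

lemma exists_radialOsc_le {F : ℂ → ℂ} (hF : DifferentiableOn ℂ F unitDisc)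
    (hmap : ∀ z ∈ unitDisc, F z ∈ unitDisc)
    (hcar : IsCarleson ((volume.restrict unitDisc).withDensity (hypDensity F))) :
    ∃ C : ℝ, 0 < C ∧ ∀ (R : ℝ) (a : ℂ), 0 < R → R < 1 → ‖a‖ < 1 →
      radialOsc F R a ≤ ENNReal.ofReal C := by
  obtain ⟨C, hC, h⟩ := exists_hypPotential_le hF hcar
  refine ⟨20 * C + 2 * π, by positivity, fun R a hR0 hR ha => ?_⟩
  refine (lintegral_oscillation_le hF hmap hR0 hR ha one_pos).trans ?_
  have h1 := h (R * a) (norm_ofReal_mul_lt_one hR0 hR ha.le)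
  calc _ ≤ 4 * ENNReal.ofReal C + ENNReal.ofReal (2 * π * 1) +
        ENNReal.ofReal (16 / 1) * ENNReal.ofReal C := by gcongr
    _ = _ := by
      rw [← ENNReal.ofReal_ofNat 4, ← ENNReal.ofReal_mul (by positivity),
        ← ENNReal.ofReal_mul (by positivity), ← ENNReal.ofReal_add (by positivity) (by positivity),
        ← ENNReal.ofReal_add (by positivity) (by positivity)]
      congr 1
      ring

lemma exists_radialOsc_le_of_vanishing {F : ℂ → ℂ} (hF : DifferentiableOn ℂ F unitDisc)
    (hmap : ∀ z ∈ unitDisc, F z ∈ unitDisc)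
    (hcar : IsVanishingCarleson ((volume.restrict unitDisc).withDensity (hypDensity F)))
    {ε : ℝ} (hε : 0 < ε) :
    ∃ δ : ℝ, 0 < δ ∧ δ < 1 ∧ ∀ (R : ℝ) (a : ℂ), 0 < R → R < 1 → ‖a‖ < 1 → 1 - δ ≤ R * ‖a‖ →
      radialOsc F R a ≤ ENNReal.ofReal ε := by
  set η := ε / (4 * π) with hη
  have hη0 : 0 < η := by positivity
  set γ := ε / (2 * (4 + 16 / η)) with hγ
  have hγ0 : 0 < γ := by positivity
  obtain ⟨δ, hδ0, hδ1, h⟩ := exists_hypPotential_le_of_vanishing hF hcar hγ0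
  refine ⟨δ, hδ0, hδ1, fun R a hR0 hR ha hRa => ?_⟩
  refine (lintegral_oscillation_le hF hmap hR0 hR ha hη0).trans ?_
  have h1 := h (R * a) (by rwa [norm_mul, norm_real, Real.norm_of_nonneg hR0.le])
    (norm_ofReal_mul_lt_one hR0 hR ha.le)
  calc _ ≤ 4 * ENNReal.ofReal γ + ENNReal.ofReal (2 * π * η) +
        ENNReal.ofReal (16 / η) * ENNReal.ofReal γ := by gcongr
    _ = _ := by
      rw [← ENNReal.ofReal_ofNat 4, ← ENNReal.ofReal_mul (by positivity),
        ← ENNReal.ofReal_mul (by positivity), ← ENNReal.ofReal_add (by positivity) (by positivity),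
        ← ENNReal.ofReal_add (by positivity) (by positivity)]
      congr 1
      have e1 : 4 * γ + 16 / η * γ = ε / 2 := by
        rw [← add_mul, hγ]
        field_simp
      have e2 : 2 * π * η = ε / 2 := by
        rw [hη]
        field_simp
        norm_num
      linarith

lemma le_discKernel_of_mem_arc {θ₀ t θ : ℝ} (ht : 0 < t) (ht1 : t ≤ 1)
    (hθ : θ ∈ Ioo (θ₀ - π * t) (θ₀ + π * t)) :
    1 ≤ 18 * t * discKernel (((1 - t : ℝ) : ℂ) * circlePt θ₀) (circlePt θ) := by
  have hn : ‖((1 - t : ℝ) : ℂ) * circlePt θ₀‖ = 1 - t := by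
    rw [norm_mul, norm_circlePt, norm_real, Real.norm_of_nonneg (by linarith), mul_one]
  have e : ‖1 - conj (((1 - t : ℝ) : ℂ) * circlePt θ₀) * circlePt θ‖ ^ 2 =
      t ^ 2 + 2 * (1 - t) * (1 - Real.cos (θ - θ₀)) := by
    rw [map_mul, conj_circlePt, conj_ofReal, mul_assoc, ← circlePt_add,
      norm_sq_one_sub_mul_circlePt, neg_add_eq_sub]
    ring
  have hcos : 1 - Real.cos (θ - θ₀) ≤ (θ - θ₀) ^ 2 / 2 := by
    linarith [Real.one_sub_sq_div_two_le_cos (x := θ - θ₀)]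
  have hsq : (θ - θ₀) ^ 2 ≤ (π * t) ^ 2 := by
    rw [sq_le_sq, abs_of_pos (mul_pos Real.pi_pos ht), abs_le]
    constructor <;> linarith [hθ.1, hθ.2]
  have hpi : π ^ 2 ≤ 16 := by nlinarith [Real.pi_le_four, Real.pi_pos]
  have hc0 : 0 ≤ 1 - Real.cos (θ - θ₀) := by linarith [Real.cos_le_one (θ - θ₀)]
  have hD : t ^ 2 + 2 * (1 - t) * (1 - Real.cos (θ - θ₀)) ≤ 18 * t ^ 2 := by
    have h1 : (π * t) ^ 2 ≤ 16 * t ^ 2 := by rw [mul_pow]; gcongr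
    nlinarith
  have hpos : 0 < t ^ 2 + 2 * (1 - t) * (1 - Real.cos (θ - θ₀)) := by
    have : 0 ≤ 2 * (1 - t) * (1 - Real.cos (θ - θ₀)) :=
      mul_nonneg (by linarith) hc0
    positivity
  rw [discKernel, e, hn, ← mul_div_assoc, one_le_div hpos]
  nlinarith

lemma lintegral_arc_le {F : ℂ → ℂ} {θ₀ t R : ℝ} (ht : 0 < t) (ht1 : t ≤ 1) :
    ∫⁻ θ in Ioo (θ₀ - π * t) (θ₀ + π * t), ENNReal.ofReal
      |logDefect (F (R * circlePt θ)) - logDefect (F (R * (((1 - t : ℝ) : ℂ) * circlePt θ₀)))| ≤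
    ENNReal.ofReal (18 * t) * radialOsc F R (((1 - t : ℝ) : ℂ) * circlePt θ₀) := by
  set a := ((1 - t : ℝ) : ℂ) * circlePt θ₀ with ha
  have hper := setLIntegral_Ioc_eq_of_periodic (g := fun θ => ENNReal.ofReal
    (|logDefect (F (R * circlePt θ)) - logDefect (F (R * a))| * discKernel a (circlePt θ)))
    (fun θ => by simp only [circlePt_add_two_pi]) 0 (θ₀ - π * t)
  rw [zero_add] at hper
  rw [radialOsc, hper, ← lintegral_const_mul' _ _ ENNReal.ofReal_ne_top]
  calc _ ≤ ∫⁻ θ in Ioo (θ₀ - π * t) (θ₀ + π * t), ENNReal.ofReal (18 * t) * ENNReal.ofReal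
        (|logDefect (F (R * circlePt θ)) - logDefect (F (R * a))| * discKernel a (circlePt θ)) := by
        refine setLIntegral_mono' measurableSet_Ioo fun θ hθ => ?_
        rw [← ENNReal.ofReal_mul (by positivity)]
        refine ENNReal.ofReal_le_ofReal ?_
        have h1 := le_discKernel_of_mem_arc ht ht1 hθ
        calc _ ≤ |logDefect (F (R * circlePt θ)) - logDefect (F (R * a))| *
              (18 * t * discKernel a (circlePt θ)) := le_mul_of_one_le_right (abs_nonneg _) h1
          _ = _ := by ring
    _ ≤ _ := by
        refine lintegral_mono_set fun θ hθ => ⟨hθ.1, hθ.2.le.trans ?_⟩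
        nlinarith [Real.pi_pos]

/-- The radial boundary function. -/
def radialLimit (F : ℂ → ℂ) (θ : ℝ) : ℂ :=
  limUnder (𝓝[<] (1 : ℝ)) fun r : ℝ => F (r * circlePt θ)

lemma ae_tendsto_radialLimit {F : ℂ → ℂ} (hF : DifferentiableOn ℂ F unitDisc)
    (hmap : ∀ z ∈ unitDisc, F z ∈ unitDisc) :
    ∀ᵐ θ : ℝ, Tendsto (fun r : ℝ => F (r * circlePt θ)) (𝓝[<] 1) (𝓝 (radialLimit F θ)) := by
  filter_upwards [exists_radial_limit hF hmap] with θ hθ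
  exact tendsto_nhds_limUnder hθ

/-- A sequence of radii increasing to one. -/
def radius (n : ℕ) : ℝ := 1 - 1 / ((n : ℝ) + 2)

lemma radius_pos (n : ℕ) : 0 < radius n := by
  have : 1 / ((n : ℝ) + 2) < 1 := by
    rw [div_lt_one (by positivity)]
    linarith [(Nat.cast_nonneg n : (0 : ℝ) ≤ n)]
  unfold radius
  linarith

lemma radius_lt_one (n : ℕ) : radius n < 1 := by
  have : 0 < 1 / ((n : ℝ) + 2) := by positivity
  unfold radius
  linarith

lemma tendsto_radius : Tendsto radius atTop (𝓝 1) := by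
  have h : Tendsto (fun n : ℕ => 1 / ((n : ℝ) + 2)) atTop (𝓝 0) :=
    tendsto_const_nhds.div_atTop (tendsto_atTop_add_const_right _ _ tendsto_natCast_atTop_atTop)
  have h' := h.const_sub 1
  rwa [sub_zero] at h'

lemma tendsto_radius_nhdsLT : Tendsto radius atTop (𝓝[<] 1) :=
  tendsto_nhdsWithin_iff.2 ⟨tendsto_radius, Eventually.of_forall radius_lt_one⟩

lemma continuous_comp_mul_circlePt {F : ℂ → ℂ} (hF : DifferentiableOn ℂ F unitDisc) {R : ℝ}
    (hR0 : 0 < R) (hR : R < 1) : Continuous fun θ => F (R * circlePt θ) := by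
  have hc := continuous_circlePt
  exact hF.continuousOn.comp_continuous (by fun_prop) fun θ =>
    norm_ofReal_mul_lt_one hR0 hR (norm_circlePt θ).le

lemma continuous_logDefect_comp_mul_circlePt {F : ℂ → ℂ} (hF : DifferentiableOn ℂ F unitDisc)
    (hmap : ∀ z ∈ unitDisc, F z ∈ unitDisc) {R : ℝ} (hR0 : 0 < R) (hR : R < 1) :
    Continuous fun θ => logDefect (F (R * circlePt θ)) :=
  continuousOn_logDefect.comp_continuous (continuous_comp_mul_circlePt hF hR0 hR) fun θ =>
    hmap _ (norm_ofReal_mul_lt_one hR0 hR (norm_circlePt θ).le)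

lemma aemeasurable_radialLimit {F : ℂ → ℂ} (hF : DifferentiableOn ℂ F unitDisc)
    (hmap : ∀ z ∈ unitDisc, F z ∈ unitDisc) : AEMeasurable (radialLimit F) := by
  refine aemeasurable_of_tendsto_metrizable_ae atTop (f := fun n θ => F (radius n * circlePt θ))
    (fun n => (continuous_comp_mul_circlePt hF (radius_pos n) (radius_lt_one n)).aemeasurable) ?_
  filter_upwards [ae_tendsto_radialLimit hF hmap] with θ hθ
  exact hθ.comp tendsto_radius_nhdsLT

lemma tendsto_logDefect_atTop {w : ℕ → ℂ} {c : ℂ} (hw : Tendsto w atTop (𝓝 c))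
    (hlt : ∀ n, ‖w n‖ < 1) (hc : ‖c‖ = 1) :
    Tendsto (fun n => logDefect (w n)) atTop atTop := by
  unfold logDefect
  refine tendsto_neg_atBot_atTop.comp (Real.tendsto_log_nhdsGT_zero.comp ?_)
  refine tendsto_nhdsWithin_iff.2 ⟨?_, Eventually.of_forall fun n => one_sub_norm_sq_pos (hlt n)⟩
  have h : Tendsto (fun n => 1 - ‖w n‖ ^ 2) atTop (𝓝 (1 - ‖c‖ ^ 2)) :=
    (hw.norm.pow 2).const_sub 1
  simpa [hc] using h

/-- Oscillation bounds on circles pass to the boundary function. -/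
lemma radialLimit_arc {F : ℂ → ℂ} (hF : DifferentiableOn ℂ F unitDisc)
    (hmap : ∀ z ∈ unitDisc, F z ∈ unitDisc) {θ₀ t β : ℝ} (ht : 0 < t) (ht1 : t ≤ 1)
    (hβ : ∀ᶠ n in atTop,
      radialOsc F (radius n) (((1 - t : ℝ) : ℂ) * circlePt θ₀) ≤ ENNReal.ofReal β) :
    (∀ᵐ θ ∂(volume.restrict (Ioo (θ₀ - π * t) (θ₀ + π * t))), ‖radialLimit F θ‖ < 1) ∧
    ∫⁻ θ in Ioo (θ₀ - π * t) (θ₀ + π * t), ENNReal.ofReal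
      |logDefect (radialLimit F θ) - logDefect (F (((1 - t : ℝ) : ℂ) * circlePt θ₀))| ≤
      ENNReal.ofReal (18 * t * β) := by
  set a := ((1 - t : ℝ) : ℂ) * circlePt θ₀ with ha
  have hn : ‖a‖ < 1 := by
    rw [ha, norm_mul, norm_circlePt, norm_real, Real.norm_of_nonneg (by linarith), mul_one]
    linarith
  set S := Ioo (θ₀ - π * t) (θ₀ + π * t) with hS
  set v : ℕ → ℝ → ℝ≥0∞ := fun n θ => ENNReal.ofReal
    |logDefect (F (radius n * circlePt θ)) - logDefect (F (radius n * a))| with hv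
  have hmem : ∀ n θ, ‖F (radius n * circlePt θ)‖ < 1 := fun n θ =>
    hmap _ (norm_ofReal_mul_lt_one (radius_pos n) (radius_lt_one n) (norm_circlePt θ).le)
  have hlim_a : Tendsto (fun n => logDefect (F (radius n * a))) atTop (𝓝 (logDefect (F a))) := by
    have h1 : ContinuousAt (logDefect ∘ F) a := by
      refine ContinuousAt.comp ?_ ?_
      · refine continuousOn_logDefect.continuousAt (IsOpen.mem_nhds ?_ (hmap a hn))
        exact isOpen_lt continuous_norm continuous_const
      · refine hF.continuousOn.continuousAt (IsOpen.mem_nhds ?_ hn)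
        exact isOpen_lt continuous_norm continuous_const
    have h2 : Tendsto (fun n => (radius n : ℂ) * a) atTop (𝓝 a) := by
      simpa using ((continuous_ofReal.tendsto _).comp tendsto_radius).mul_const a
    exact h1.tendsto.comp h2
  have hfatou : ∫⁻ θ in S, liminf (fun n => v n θ) atTop ≤ ENNReal.ofReal (18 * t * β) := by
    refine (lintegral_liminf_le fun n => ?_).trans ?_
    · have := continuous_logDefect_comp_mul_circlePt hF hmap (radius_pos n) (radius_lt_one n)
      exact (ENNReal.continuous_ofReal.comp (by fun_prop)).measurable
    · refine liminf_le_of_frequently_le' (Eventually.frequently ?_)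
      filter_upwards [hβ] with n h
      refine (lintegral_arc_le ht ht1).trans ?_
      rw [ENNReal.ofReal_mul (p := 18 * t) (by positivity)]
      exact mul_le_mul_right h _
  have hfin : ∀ᵐ θ ∂(volume.restrict S), liminf (fun n => v n θ) atTop < ∞ := by
    refine ae_lt_top' (Measurable.aemeasurable ?_) (hfatou.trans_lt ENNReal.ofReal_lt_top).ne
    refine Measurable.liminf fun n => ?_
    have := continuous_logDefect_comp_mul_circlePt hF hmap (radius_pos n) (radius_lt_one n)
    exact (ENNReal.continuous_ofReal.comp (by fun_prop)).measurable
  have htend := ae_restrict_of_ae (s := S) (ae_tendsto_radialLimit hF hmap)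
  have hlt : ∀ᵐ θ ∂(volume.restrict S), ‖radialLimit F θ‖ < 1 := by
    filter_upwards [hfin, htend] with θ h1 h2
    have h3 := h2.comp tendsto_radius_nhdsLT
    refine lt_of_le_of_ne (le_of_tendsto h3.norm
      (Eventually.of_forall fun n => (hmem n θ).le)) fun h4 => ?_
    have h5 := tendsto_logDefect_atTop h3 (fun n => hmem n θ) h4
    have h6 : Tendsto (fun n => logDefect (F (radius n * circlePt θ)) -
        logDefect (F (radius n * a))) atTop atTop := h5.atTop_add hlim_a.neg
    have h7 : Tendsto (fun n => v n θ) atTop (𝓝 ∞) :=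
      ENNReal.tendsto_ofReal_atTop.comp (tendsto_abs_atTop_atTop.comp h6)
    rw [h7.liminf_eq] at h1
    exact lt_irrefl _ h1
  refine ⟨hlt, le_trans (le_of_eq ?_) hfatou⟩
  refine lintegral_congr_ae ?_
  filter_upwards [hlt, htend] with θ h1 h2
  have h3 : Tendsto (fun n => logDefect (F (radius n * circlePt θ))) atTop
      (𝓝 (logDefect (radialLimit F θ))) :=
    (continuousOn_logDefect.continuousAt (IsOpen.mem_nhds
      (isOpen_lt continuous_norm continuous_const) h1)).tendsto.comp
      (h2.comp tendsto_radius_nhdsLT)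
  exact (((ENNReal.continuous_ofReal.comp continuous_abs).tendsto _).comp
    (h3.sub hlim_a)).liminf_eq.symm

lemma meanOsc_le_of_integral_le {f : ℝ → ℂ} {θ₀ t B : ℝ} {c : ℂ} (ht : 0 < t)
    (hf : IntegrableOn f (Ioo (θ₀ - π * t) (θ₀ + π * t)))
    (hB : ∫ θ in Ioo (θ₀ - π * t) (θ₀ + π * t), ‖f θ - c‖ ≤ 2 * π * t * B) :
    meanOsc f θ₀ t ≤ 2 * B := by
  set S := Ioo (θ₀ - π * t) (θ₀ + π * t) with hS
  have hL : 0 < 2 * π * t := by positivity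
  have hvol : volume.real S = 2 * π * t := by
    rw [hS, Real.volume_real_Ioo_of_le (by nlinarith [Real.pi_pos])]
    ring
  have hconst : ∀ d : ℂ, IntegrableOn (fun _ : ℝ => d) S := fun d =>
    integrableOn_const (by rw [hS]; exact measure_Ioo_lt_top.ne)
  have havg : ‖arcAvg f θ₀ t - c‖ ≤ B := by
    have e : arcAvg f θ₀ t - c = ((2 * π * t)⁻¹ : ℝ) • ∫ θ in S, (f θ - c) := by
      rw [integral_sub hf (hconst c), setIntegral_const, hvol, smul_sub, smul_smul,
        inv_mul_cancel₀ hL.ne', one_smul]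
      rfl
    rw [e, norm_smul, Real.norm_of_nonneg (by positivity), inv_mul_le_iff₀ hL]
    exact (norm_integral_le_integral_norm _).trans hB
  rw [meanOsc, inv_mul_le_iff₀ hL]
  calc ∫ θ in S, ‖f θ - arcAvg f θ₀ t‖ ≤ ∫ θ in S, (‖f θ - c‖ + B) := by
        refine setIntegral_mono (hf.sub (hconst _)).norm
          ((hf.sub (hconst _)).norm.add ?_) fun θ => ?_
        · exact integrableOn_const (by rw [hS]; exact measure_Ioo_lt_top.ne)
        · calc _ = ‖(f θ - c) - (arcAvg f θ₀ t - c)‖ := by congr 1; ring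
            _ ≤ _ := (norm_sub_le _ _).trans (by gcongr)
    _ = (∫ θ in S, ‖f θ - c‖) + 2 * π * t * B := by
        have h1 : IntegrableOn (fun θ => ‖f θ - c‖) S := (hf.sub (hconst c)).norm
        rw [integral_add h1 (integrableOn_const (by rw [hS]; exact measure_Ioo_lt_top.ne)),
          setIntegral_const, hvol, smul_eq_mul]
    _ ≤ _ := by linarith

lemma radialLimit_arc_meanOsc {F : ℂ → ℂ} (hF : DifferentiableOn ℂ F unitDisc)
    (hmap : ∀ z ∈ unitDisc, F z ∈ unitDisc) {θ₀ t β : ℝ} (ht : 0 < t) (ht1 : t ≤ 1) (hβ0 : 0 ≤ β)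
    (hβ : ∀ᶠ n in atTop,
      radialOsc F (radius n) (((1 - t : ℝ) : ℂ) * circlePt θ₀) ≤ ENNReal.ofReal β) :
    IntegrableOn (fun θ => ((Real.log (1 - ‖radialLimit F θ‖ ^ 2) : ℝ) : ℂ))
      (Ioo (θ₀ - π * t) (θ₀ + π * t)) ∧
    meanOsc (fun θ => ((Real.log (1 - ‖radialLimit F θ‖ ^ 2) : ℝ) : ℂ)) θ₀ t ≤ 18 * β / π := by
  set f : ℝ → ℂ := fun θ => ((Real.log (1 - ‖radialLimit F θ‖ ^ 2) : ℝ) : ℂ) with hf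
  set a := ((1 - t : ℝ) : ℂ) * circlePt θ₀ with ha
  set S := Ioo (θ₀ - π * t) (θ₀ + π * t) with hS
  set c : ℂ := ((-logDefect (F a) : ℝ) : ℂ) with hc
  have hbd := (radialLimit_arc hF hmap ht ht1 hβ).2
  have hnorm : ∀ θ, ‖f θ - c‖ = |logDefect (radialLimit F θ) - logDefect (F a)| := fun θ => by
    rw [hf, hc, ← ofReal_sub, norm_real, Real.norm_eq_abs, ← abs_neg]
    congr 1
    simp only [logDefect]
    ring
  have hmeas : AEStronglyMeasurable (fun θ => f θ - c) (volume.restrict S) := by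
    have h1 := (aemeasurable_radialLimit hF hmap).restrict (s := S)
    have h2 : Measurable fun w : ℂ => ((Real.log (1 - ‖w‖ ^ 2) : ℝ) : ℂ) - c := by fun_prop
    exact (h2.comp_aemeasurable h1).aestronglyMeasurable
  have hlin : ∫⁻ θ in S, ‖f θ - c‖ₑ ≤ ENNReal.ofReal (18 * t * β) := by
    refine le_trans (le_of_eq ?_) hbd
    refine lintegral_congr fun θ => ?_
    rw [← ofReal_norm, hnorm]
  have hintble : IntegrableOn (fun θ => f θ - c) S :=
    ⟨hmeas, hlin.trans_lt ENNReal.ofReal_lt_top⟩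
  have hfi : IntegrableOn f S := by
    have h1 : IntegrableOn (fun _ : ℝ => c) S :=
      integrableOn_const (by rw [hS]; exact measure_Ioo_lt_top.ne)
    exact (Integrable.add hintble h1).congr (ae_of_all _ fun θ => sub_add_cancel _ _)
  refine ⟨hfi, ?_⟩
  have h2 : ∫ θ in S, ‖f θ - c‖ ≤ 2 * π * t * (9 * β / π) := by
    have e : 2 * π * t * (9 * β / π) = 18 * t * β := by field_simp; ring
    rw [integral_norm_eq_lintegral_enorm hmeas, e]
    exact ENNReal.toReal_le_of_le_ofReal (by positivity) hlin
  exact (meanOsc_le_of_integral_le ht hfi h2).trans (le_of_eq (by ring))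

/-- The boundary function of `log (1 - ‖F‖ ^ 2)` belongs to `VMO`. -/
theorem isVMO_log_radialLimit {F : ℂ → ℂ} (hF : DifferentiableOn ℂ F unitDisc)
    (hmap : ∀ z ∈ unitDisc, F z ∈ unitDisc)
    (hcar : IsVanishingCarleson ((volume.restrict unitDisc).withDensity (hypDensity F))) :
    (∀ᵐ θ ∂(volume.restrict (Ioc 0 (2 * π))), ‖radialLimit F θ‖ < 1) ∧
      IsVMO fun θ => ((Real.log (1 - ‖radialLimit F θ‖ ^ 2) : ℝ) : ℂ) := by
  obtain ⟨C, hC, hbd⟩ := exists_radialOsc_le hF hmap hcar.1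
  have hn : ∀ θ₀ t : ℝ, t ≤ 1 → ‖((1 - t : ℝ) : ℂ) * circlePt θ₀‖ = 1 - t := fun θ₀ t ht1 => by
    rw [norm_mul, norm_circlePt, norm_real, Real.norm_of_nonneg (by linarith), mul_one]
  have hbd' : ∀ θ₀ t : ℝ, 0 < t → t ≤ 1 → ∀ᶠ n in atTop,
      radialOsc F (radius n) (((1 - t : ℝ) : ℂ) * circlePt θ₀) ≤ ENNReal.ofReal C :=
    fun θ₀ t ht ht1 => Eventually.of_forall fun n =>
      hbd _ _ (radius_pos n) (radius_lt_one n) (by rw [hn _ _ ht1]; linarith)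
  have e : Ioo (π - π * 1) (π + π * 1) = Ioo 0 (2 * π) := by
    congr 1 <;> ring
  refine ⟨?_, ⟨fun θ => by simp only [radialLimit, circlePt_add_two_pi], ?_, 18 * C / π,
    fun θ₀ t ht ht1 => (radialLimit_arc_meanOsc hF hmap ht ht1 hC.le (hbd' θ₀ t ht ht1)).2⟩,
    fun ε hε => ?_⟩
  · have h := (radialLimit_arc hF hmap one_pos le_rfl (hbd' π 1 one_pos le_rfl)).1
    rw [e] at h
    rwa [restrict_Ioo_eq_restrict_Ioc] at h
  · have h := (radialLimit_arc_meanOsc hF hmap one_pos le_rfl hC.le (hbd' π 1 one_pos le_rfl)).1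
    rw [e] at h
    exact (integrableOn_Ioc_iff_integrableOn_Ioo (by simp)).2 h
  · obtain ⟨δ, hδ0, hδ1, h⟩ := exists_radialOsc_le_of_vanishing hF hmap hcar
      (ε := ε * π / 18) (by positivity)
    refine ⟨δ, hδ0, fun θ₀ t ht htδ => ?_⟩
    have ht1 : t ≤ 1 := by linarith
    have hlim : Tendsto (fun n => radius n * (1 - t)) atTop (𝓝 (1 * (1 - t))) :=
      tendsto_radius.mul_const _
    have hev : ∀ᶠ n in atTop, radialOsc F (radius n) (((1 - t : ℝ) : ℂ) * circlePt θ₀) ≤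
        ENNReal.ofReal (ε * π / 18) := by
      filter_upwards [hlim.eventually_const_lt (u := 1 - δ) (by linarith)] with n hn'
      refine h _ _ (radius_pos n) (radius_lt_one n) ?_ ?_ <;> rw [hn _ _ ht1] <;> linarith
    refine (radialLimit_arc_meanOsc hF hmap ht ht1 (by positivity) hev).2.trans (le_of_eq ?_)
    field_simp

end VanishingOscillation

section WeightedDirichlet

open Complex Metric
open scoped Real ENNReal ComplexConjugate

lemma hasSum_choose_mul_natCast_mul_pow (j : ℕ) {q : ℝ} (hq0 : 0 ≤ q) (hq : q < 1) :
    HasSum (fun n : ℕ => ((n + j).choose j : ℝ) * (n * q ^ (n - 1)))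
      ((j + 1) / (1 - q) ^ (j + 2)) := by
  have h := (hasSum_choose_mul_geometric_of_norm_lt_one (𝕜 := ℝ) (j + 1) (r := q)
    (by rwa [Real.norm_of_nonneg hq0])).mul_left ((j : ℝ) + 1)
  rw [mul_one_div] at h
  rw [← hasSum_nat_add_iff' 1]
  simp only [Finset.range_one, Finset.sum_singleton, Nat.cast_zero, zero_mul, mul_zero, sub_zero]
  refine h.congr_fun fun n => ?_
  have h1 := Nat.choose_succ_right_eq (n + 1 + j) j
  rw [show n + 1 + j - j = n + 1 by omega] at h1
  have h2 : (((n + 1 + j).choose (j + 1) : ℕ) : ℝ) * (j + 1) =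
      ((n + 1 + j).choose j : ℕ) * (n + 1) := by exact_mod_cast h1
  rw [show n + (j + 1) = n + 1 + j by ring, Nat.add_sub_cancel]
  push_cast
  linear_combination -q ^ n * h2

lemma hasSum_choose_mul_natCast_sq_mul_pow (j : ℕ) {q : ℝ} (hq0 : 0 ≤ q) (hq : q < 1) :
    HasSum (fun n : ℕ => ((n + j).choose j : ℝ) * (n ^ 2 * q ^ (n - 1)))
      ((j + 1) * (1 + (j + 1) * q) / (1 - q) ^ (j + 3)) := by
  have h0 := hasSum_choose_mul_geometric_of_norm_lt_one (𝕜 := ℝ) (j + 1) (r := q)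
    (by rwa [Real.norm_of_nonneg hq0])
  have h1 := (hasSum_choose_mul_natCast_mul_pow (j + 1) hq0 hq).mul_left q
  have h := (h1.add h0).mul_left ((j : ℝ) + 1)
  have hD : 1 - q ≠ 0 := by linarith
  have e : ((j : ℝ) + 1) * (q * (((j + 1 : ℕ) + 1) / (1 - q) ^ (j + 1 + 2)) +
      1 / (1 - q) ^ (j + 1 + 1)) = (j + 1) * (1 + (j + 1) * q) / (1 - q) ^ (j + 3) := by
    push_cast
    field_simp
    ring
  rw [e] at h
  rw [← hasSum_nat_add_iff' 1]
  simp only [Finset.range_one, Finset.sum_singleton, Nat.cast_zero, zero_mul, mul_zero, sub_zero,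
    ne_eq, OfNat.ofNat_ne_zero, not_false_eq_true, zero_pow]
  refine h.congr_fun fun n => ?_
  have h1 := Nat.choose_succ_right_eq (n + 1 + j) j
  rw [show n + 1 + j - j = n + 1 by omega] at h1
  have h2 : (((n + 1 + j).choose (j + 1) : ℕ) : ℝ) * (j + 1) =
      ((n + 1 + j).choose j : ℕ) * (n + 1) := by exact_mod_cast h1
  have h3 : q * ((n : ℝ) * q ^ (n - 1)) = n * q ^ n := by
    rcases n with _ | n
    · simp
    · rw [Nat.add_sub_cancel, pow_succ]; ring
  rw [show n + (j + 1) = n + 1 + j by ring, Nat.add_sub_cancel]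
  push_cast
  linear_combination -(n + 1) * q ^ n * h2 -
    ((j : ℝ) + 1) * ((n + 1 + j).choose (j + 1) : ℕ) * h3

lemma norm_sq_natCast_mul_add (n : ℕ) (w x y : ℂ) :
    ‖(n : ℂ) * w ^ (n - 1) * x + w ^ n * y‖ ^ 2 =
      n ^ 2 * (‖w‖ ^ 2) ^ (n - 1) * ‖x‖ ^ 2 +
        n * (‖w‖ ^ 2) ^ (n - 1) * (2 * (x * conj (w * y)).re) + (‖w‖ ^ 2) ^ n * ‖y‖ ^ 2 := by
  rcases n with _ | n
  · simp
  · rw [Nat.add_sub_cancel]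
    have e : ((n + 1 : ℕ) : ℂ) * w ^ n * x + w ^ (n + 1) * y =
        w ^ n * (((n + 1 : ℕ) : ℝ) * x + w * y) := by
      push_cast
      ring
    rw [e, norm_mul, mul_pow, ← normSq_eq_norm_sq (_ + _), normSq_add, normSq_eq_norm_sq,
      normSq_eq_norm_sq, norm_mul, norm_mul, norm_real, norm_pow, mul_assoc (_ : ℂ) x, re_ofReal_mul,
      Real.norm_of_nonneg (by positivity)]
    ring

/-- Completing the square in the weighted series. -/
lemma le_tsum_choose_mul_norm_sq (j : ℕ) {w : ℂ} (hw : ‖w‖ < 1) (x y : ℂ) :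
    ENNReal.ofReal ((j + 1) * ‖x‖ ^ 2 / (1 - ‖w‖ ^ 2) ^ (j + 3)) ≤
      ∑' n : ℕ, ENNReal.ofReal ((n + j).choose j) *
        ENNReal.ofReal (‖(n : ℂ) * w ^ (n - 1) * x + w ^ n * y‖ ^ 2) := by
  have hq0 : 0 ≤ ‖w‖ ^ 2 := by positivity
  have hD := one_sub_norm_sq_pos hw
  set D := 1 - ‖w‖ ^ 2 with hDdef
  have hq : ‖w‖ ^ 2 < 1 := by linarith
  have h0 := (hasSum_choose_mul_geometric_of_norm_lt_one (𝕜 := ℝ) j (r := ‖w‖ ^ 2)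
    (by rwa [Real.norm_of_nonneg hq0])).mul_right (‖y‖ ^ 2)
  have h1 := (hasSum_choose_mul_natCast_mul_pow j hq0 hq).mul_right (2 * (x * conj (w * y)).re)
  have h2 := (hasSum_choose_mul_natCast_sq_mul_pow j hq0 hq).mul_right (‖x‖ ^ 2)
  have h := ((h2.add h1).add h0).congr_fun
    (g := fun n : ℕ => ((n + j).choose j : ℝ) * ‖(n : ℂ) * w ^ (n - 1) * x + w ^ n * y‖ ^ 2)
    fun n => by rw [norm_sq_natCast_mul_add]; ring
  have e : ∑' n : ℕ, ENNReal.ofReal ((n + j).choose j) *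
      ENNReal.ofReal (‖(n : ℂ) * w ^ (n - 1) * x + w ^ n * y‖ ^ 2) =
      ENNReal.ofReal (∑' n : ℕ, ((n + j).choose j : ℝ) *
        ‖(n : ℂ) * w ^ (n - 1) * x + w ^ n * y‖ ^ 2) := by
    rw [ENNReal.ofReal_tsum_of_nonneg (fun n => by positivity) h.summable]
    exact tsum_congr fun n => (ENNReal.ofReal_mul (by positivity)).symm
  rw [e, h.tsum_eq]
  refine ENNReal.ofReal_le_ofReal ?_
  rw [← hDdef]
  have hsq : 0 ≤ ‖((j + 1 : ℝ) : ℂ) * (conj w * x) + (D : ℂ) * y‖ ^ 2 := by positivity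
  have hexp : ‖((j + 1 : ℝ) : ℂ) * (conj w * x) + (D : ℂ) * y‖ ^ 2 =
      (j + 1) ^ 2 * ‖w‖ ^ 2 * ‖x‖ ^ 2 + D ^ 2 * ‖y‖ ^ 2 +
        2 * ((j + 1) * D * (x * conj (w * y)).re) := by
    rw [← normSq_eq_norm_sq, normSq_add, normSq_eq_norm_sq, normSq_eq_norm_sq, norm_mul, norm_mul,
      norm_mul, norm_real, norm_real, norm_conj, Real.norm_of_nonneg hD.le,
      Real.norm_of_nonneg (by positivity), map_mul, conj_ofReal]
    rw [show ((j + 1 : ℝ) : ℂ) * (conj w * x) * ((D : ℂ) * conj y) =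
      ((((j + 1) * D : ℝ)) : ℂ) * (x * conj (w * y)) by rw [map_mul]; push_cast; ring, re_ofReal_mul]
    ring
  rw [hexp] at hsq
  have key : (j + 1) * (1 + (j + 1) * ‖w‖ ^ 2) / D ^ (j + 3) * ‖x‖ ^ 2 +
      (j + 1) / D ^ (j + 2) * (2 * (x * conj (w * y)).re) + 1 / D ^ (j + 1) * ‖y‖ ^ 2 =
      (j + 1) * ‖x‖ ^ 2 / D ^ (j + 3) + ((j + 1) ^ 2 * ‖w‖ ^ 2 * ‖x‖ ^ 2 + D ^ 2 * ‖y‖ ^ 2 +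
        2 * ((j + 1) * D * (x * conj (w * y)).re)) / D ^ (j + 3) := by
    field_simp
    ring
  rw [key]
  have : 0 ≤ ((j + 1) ^ 2 * ‖w‖ ^ 2 * ‖x‖ ^ 2 + D ^ 2 * ‖y‖ ^ 2 +
        2 * ((j + 1) * D * (x * conj (w * y)).re)) / D ^ (j + 3) := by positivity
  linarith

lemma tsum_choose_mul_pow (j : ℕ) {w : ℂ} (hw : ‖w‖ < 1) :
    ∑' n : ℕ, ENNReal.ofReal ((n + j).choose j) * ENNReal.ofReal (‖w‖ ^ (2 * n)) =
      ENNReal.ofReal (1 / (1 - ‖w‖ ^ 2) ^ (j + 1)) := by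
  have hD := one_sub_norm_sq_pos hw
  have h := hasSum_choose_mul_geometric_of_norm_lt_one (𝕜 := ℝ) j (r := ‖w‖ ^ 2)
    (by rw [Real.norm_of_nonneg (by positivity)]; linarith)
  rw [← h.tsum_eq, ENNReal.ofReal_tsum_of_nonneg (fun n => by positivity) h.summable]
  exact tsum_congr fun n => by rw [← ENNReal.ofReal_mul (by positivity), pow_mul]

lemma tsum_choose_mul_sq_mul_pow_le (j : ℕ) {w : ℂ} (hw : ‖w‖ < 1) :
    ∑' n : ℕ, ENNReal.ofReal ((n + j).choose j) *
      ENNReal.ofReal (n ^ 2 * ‖w‖ ^ (2 * (n - 1))) ≤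
      ENNReal.ofReal ((j + 1) * (j + 2) / (1 - ‖w‖ ^ 2) ^ (j + 3)) := by
  have hD := one_sub_norm_sq_pos hw
  have hq : ‖w‖ ^ 2 < 1 := by linarith
  have h := hasSum_choose_mul_natCast_sq_mul_pow j (by positivity) hq
  have e : ∑' n : ℕ, ENNReal.ofReal ((n + j).choose j) *
      ENNReal.ofReal (n ^ 2 * ‖w‖ ^ (2 * (n - 1))) =
      ENNReal.ofReal (∑' n : ℕ, ((n + j).choose j : ℝ) * (n ^ 2 * (‖w‖ ^ 2) ^ (n - 1))) := by
    rw [ENNReal.ofReal_tsum_of_nonneg (fun n => by positivity) h.summable]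
    exact tsum_congr fun n => by rw [← ENNReal.ofReal_mul (by positivity), pow_mul]
  rw [e, h.tsum_eq]
  refine ENNReal.ofReal_le_ofReal ?_
  have h3 : 1 + ((j : ℝ) + 1) * ‖w‖ ^ 2 ≤ j + 2 := by nlinarith [(Nat.cast_nonneg j : (0 : ℝ) ≤ j)]
  exact div_le_div_of_nonneg_right (mul_le_mul_of_nonneg_left h3 (by positivity)) (by positivity)

/-- The weighted Dirichlet integral of `f` with weight `(1 - ‖f‖ ^ 2) ^ (-(k + 2))`. -/
def defectDensity (f : ℂ → ℂ) (k : ℕ) (z : ℂ) : ℝ :=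
  ‖deriv f z‖ ^ 2 * (1 - ‖z‖ ^ 2) / (1 - ‖f z‖ ^ 2) ^ (k + 2)

lemma lintegral_defect_pow_le {f : ℂ → ℂ} {ρ : ℝ} (hρ : 1 < ρ)
    (hf : DifferentiableOn ℂ f (ball 0 ρ)) (hf1 : ∀ z ∈ ball (0 : ℂ) ρ, ‖f z‖ < 1) (j : ℕ) :
    ∫⁻ θ in Ioc 0 (2 * π), ENNReal.ofReal (1 / (1 - ‖f (circlePt θ)‖ ^ 2) ^ (j + 1)) ≤
      ENNReal.ofReal (2 * π * (1 / (1 - ‖f 0‖ ^ 2) ^ (j + 1))) +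
      ENNReal.ofReal (4 * ((j + 1) * (j + 2))) *
        ∫⁻ z in unitDisc, ENNReal.ofReal (defectDensity f (j + 1) z) := by
  have hms : MeasurableSet unitDisc := by rw [unitDisc_eq_ball]; exact measurableSet_ball
  have h := lintegral_series_le hρ hf fun n => ENNReal.ofReal ((n + j).choose j)
  simp_rw [tsum_choose_mul_pow j (hf1 _ (show circlePt _ ∈ ball (0 : ℂ) ρ by simpa using hρ))] at h
  rw [tsum_choose_mul_pow j (hf1 0 (by simpa using zero_lt_one.trans hρ)),
    ← ENNReal.ofReal_mul (by positivity)] at h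
  refine h.trans (add_le_add_right ?_ _)
  rw [ENNReal.ofReal_mul (by norm_num), ENNReal.ofReal_ofNat, mul_assoc,
    ← lintegral_const_mul' _ _ ENNReal.ofReal_ne_top]
  refine mul_le_mul_right (setLIntegral_mono' hms fun z hz => ?_) _
  have hz1 : ‖z‖ < 1 := hz
  have hw := hf1 z (by simpa using hz1.trans hρ)
  refine (mul_le_mul_left (tsum_choose_mul_sq_mul_pow_le j hw) _).trans (le_of_eq ?_)
  have := one_sub_norm_sq_pos hw
  rw [← ENNReal.ofReal_mul (by positivity), ← ENNReal.ofReal_mul (by positivity), defectDensity]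
  congr 1
  field_simp

lemma lintegral_defectDensity_mul_le {f g : ℂ → ℂ} {ρ : ℝ} (hρ : 1 < ρ)
    (hf : DifferentiableOn ℂ f (ball 0 ρ)) (hf1 : ∀ z ∈ ball (0 : ℂ) ρ, ‖f z‖ < 1)
    (hg : DifferentiableOn ℂ g (ball 0 ρ)) (j : ℕ) :
    2 * ∫⁻ z in unitDisc, ENNReal.ofReal ((j + 1) * (‖g z‖ ^ 2 * defectDensity f (j + 1) z)) ≤
      ∫⁻ θ in Ioc 0 (2 * π),
        ENNReal.ofReal (‖g (circlePt θ)‖ ^ 2 / (1 - ‖f (circlePt θ)‖ ^ 2) ^ (j + 1)) := by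
  have hms : MeasurableSet unitDisc := by rw [unitDisc_eq_ball]; exact measurableSet_ball
  set c : ℕ → ℝ≥0∞ := fun n => ENNReal.ofReal ((n + j).choose j) with hc
  have hsum : ∑' n, c n * (2 * dirichletEnergy (f ^ n * g)) ≤
      ∑' n, c n * ∫⁻ θ in Ioc 0 (2 * π), ENNReal.ofReal (‖(f ^ n * g) (circlePt θ)‖ ^ 2) := by
    gcongr with n
    exact two_mul_dirichletEnergy_le hρ ((hf.pow n).mul hg)
  have hright : ∑' n, c n * ∫⁻ θ in Ioc 0 (2 * π),
      ENNReal.ofReal (‖(f ^ n * g) (circlePt θ)‖ ^ 2) = ∫⁻ θ in Ioc 0 (2 * π),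
        ENNReal.ofReal (‖g (circlePt θ)‖ ^ 2 / (1 - ‖f (circlePt θ)‖ ^ 2) ^ (j + 1)) := by
    have hm : ∀ n, Measurable fun θ => ENNReal.ofReal (‖(f ^ n * g) (circlePt θ)‖ ^ 2) := fun n =>
      ((continuous_comp_circlePt hρ
        ((hf.pow n).mul hg).continuousOn).measurable.norm.pow_const 2).ennreal_ofReal
    simp_rw [← lintegral_const_mul _ (hm _)]
    rw [← lintegral_tsum fun n => ((hm n).const_mul _).aemeasurable]
    refine lintegral_congr fun θ => ?_
    have hw := hf1 (circlePt θ) (by simpa using hρ)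
    rw [div_eq_mul_one_div, mul_comm, ENNReal.ofReal_mul (by
      have := one_sub_norm_sq_pos hw; positivity), ← tsum_choose_mul_pow j hw,
      ← ENNReal.tsum_mul_right]
    refine tsum_congr fun n => ?_
    rw [hc, mul_assoc, Pi.mul_apply, Pi.pow_apply, norm_mul, norm_pow, mul_pow, ← pow_mul,
      mul_comm n 2, ENNReal.ofReal_mul (p := ‖f (circlePt θ)‖ ^ (2 * n)) (by positivity)]
  have hleft : 2 * ∫⁻ z in unitDisc,
      ENNReal.ofReal ((j + 1) * (‖g z‖ ^ 2 * defectDensity f (j + 1) z)) ≤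
      ∑' n, c n * (2 * dirichletEnergy (f ^ n * g)) := by
    simp_rw [mul_left_comm (c _) 2]
    rw [ENNReal.tsum_mul_left]
    refine mul_le_mul_right ?_ _
    have hm : ∀ n, Measurable fun z : ℂ =>
        ENNReal.ofReal (‖deriv (f ^ n * g) z‖ ^ 2 * (1 - ‖z‖ ^ 2)) := fun n => by
      have := measurable_deriv (f ^ n * g)
      fun_prop
    simp_rw [dirichletEnergy, ← lintegral_const_mul _ (hm _)]
    rw [← lintegral_tsum fun n => ((hm n).const_mul _).aemeasurable]
    refine setLIntegral_mono' hms fun z hz => ?_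
    have hz1 : ‖z‖ < 1 := hz
    have hz' : z ∈ ball (0 : ℂ) ρ := by simpa using hz1.trans hρ
    have hw := hf1 z hz'
    have hD := one_sub_norm_sq_pos hw
    have hfd := hf.differentiableAt (isOpen_ball.mem_nhds hz')
    have hgd := hg.differentiableAt (isOpen_ball.mem_nhds hz')
    have hd : ∀ n : ℕ, deriv (f ^ n * g) z =
        (n : ℂ) * f z ^ (n - 1) * (deriv f z * g z) + f z ^ n * deriv g z := fun n => by
      rw [deriv_mul (hfd.pow n) hgd, deriv_pow hfd, Pi.pow_apply]
      ring
    calc _ = ENNReal.ofReal ((j + 1) * ‖deriv f z * g z‖ ^ 2 / (1 - ‖f z‖ ^ 2) ^ (j + 3)) *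
          ENNReal.ofReal (1 - ‖z‖ ^ 2) := by
          rw [← ENNReal.ofReal_mul (by positivity), defectDensity, norm_mul]
          congr 1
          ring
      _ ≤ _ := mul_le_mul_left (le_tsum_choose_mul_norm_sq j hw _ (deriv g z)) _
      _ = _ := by
          rw [← ENNReal.tsum_mul_right]
          refine tsum_congr fun n => ?_
          rw [mul_assoc, ← ENNReal.ofReal_mul (by positivity), hd]
  exact hleft.trans (hsum.trans hright.le)

end WeightedDirichlet

section ExponentialMeans
open Complex Metric
open scoped Real ENNReal ComplexConjugate

/-- The holomorphic function on the disc whose real part is the Poisson integral of `u`. -/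
def herglotzExtension (u : ℂ → ℝ) (z : ℂ) : ℂ :=
  Real.circleAverage (fun ζ => herglotzRieszKernel 0 z ζ • (u ζ : ℂ)) 0 1

lemma circleIntegrable_of_continuous_circlePt {E : Type*} [NormedAddCommGroup E] {u : ℂ → E}
    (hu : Continuous fun θ => u (circlePt θ)) : CircleIntegrable u 0 1 := by
  have h : Continuous fun θ : ℝ => u (circleMap 0 1 θ) := by simpa only [circleMap_zero_one] using hu
  exact h.intervalIntegrable _ _

lemma differentiableOn_herglotzExtension {u : ℂ → ℝ} (hu : Continuous fun θ => u (circlePt θ)) :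
    DifferentiableOn ℂ (herglotzExtension u) (ball 0 1) :=
  differentiableOn_circleAverage_herglotzRieszKernel_smul
    (circleIntegrable_of_continuous_circlePt (continuous_ofReal.comp hu))

lemma re_herglotzExtension {u : ℂ → ℝ} (hu : Continuous fun θ => u (circlePt θ)) {a : ℂ}
    (ha : ‖a‖ < 1) :
    (herglotzExtension u a).re =
      (2 * π)⁻¹ * ∫ θ in 0..2 * π, u (circlePt θ) * discKernel a (circlePt θ) := by
  rw [herglotzExtension, re_circleAverage_herglotzRieszKernel_smul
    (circleIntegrable_of_continuous_circlePt hu) (by simpa using ha),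
    ← poissonKernel_eq_re_herglotzRieszKernel, Real.circleAverage_def, smul_eq_mul]
  simp only [circleMap_zero_one, Pi.smul_apply', smul_eq_mul, poissonKernel_def,
    sub_zero, norm_circlePt, one_pow, discKernel_circlePt, mul_comm]

lemma abs_logDefect_sub_re_herglotzExtension_le {F : ℂ → ℂ} (hF : DifferentiableOn ℂ F unitDisc)
    (hmap : ∀ z ∈ unitDisc, F z ∈ unitDisc) {R : ℝ} (hR0 : 0 < R) (hR : R < 1) {a : ℂ}
    (ha : ‖a‖ < 1) {β : ℝ} (hβ : 0 ≤ β) (h : radialOsc F R a ≤ ENNReal.ofReal (2 * π * β)) :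
    |logDefect (F (R * a)) - (herglotzExtension (fun ζ => logDefect (F (R * ζ))) a).re| ≤ β := by
  have hu := continuous_logDefect_comp_mul_circlePt hF hmap hR0 hR
  have hk := continuous_discKernel_circlePt ha
  have h2π : (0 : ℝ) ≤ 2 * π := by positivity
  set v : ℝ := logDefect (F (R * a)) with hv
  set G : ℝ → ℝ := fun θ => (logDefect (F (R * circlePt θ)) - v) * discKernel a (circlePt θ) with hG
  have key : (herglotzExtension (fun ζ => logDefect (F (R * ζ))) a).re - v =
      (2 * π)⁻¹ * ∫ θ in 0..2 * π, G θ := by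
    have e : ∫ θ in 0..2 * π, G θ =
        (∫ θ in 0..2 * π, logDefect (F (R * circlePt θ)) * discKernel a (circlePt θ)) -
          v * (2 * π) := by
      simp only [hG, sub_mul]
      rw [intervalIntegral.integral_sub (Continuous.intervalIntegrable (by fun_prop) _ _)
          (Continuous.intervalIntegrable (by fun_prop) _ _),
        intervalIntegral.integral_const_mul, integral_discKernel ha]
    rw [re_herglotzExtension hu ha, e]
    field_simp
  have hG2 : |∫ θ in 0..2 * π, G θ| ≤ 2 * π * β := by
    rw [← Real.norm_eq_abs, intervalIntegral.integral_of_le h2π]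
    refine (norm_integral_le_lintegral_norm _).trans ?_
    refine ENNReal.toReal_le_of_le_ofReal (by positivity) (le_trans (le_of_eq ?_) h)
    refine lintegral_congr fun θ => ?_
    rw [Real.norm_eq_abs, abs_mul,
      abs_of_pos (discKernel_pos ha (norm_circlePt θ).le)]
  rw [abs_sub_comm, key, abs_mul, abs_of_pos (by positivity), inv_mul_le_iff₀ (by positivity)]
  exact hG2

lemma norm_sq_exp_div_defect_pow {w : ℂ} (hw : ‖w‖ < 1) (N : ℕ) (h : ℂ) :
    ‖cexp (-(N / 2 * h))‖ ^ 2 / (1 - ‖w‖ ^ 2) ^ N = Real.exp (N * (logDefect w - h.re)) := by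
  have hD := one_sub_norm_sq_pos hw
  have h1 : (1 - ‖w‖ ^ 2) ^ N = Real.exp (-(N * logDefect w)) := by
    rw [logDefect, mul_neg, neg_neg, Real.exp_nat_mul, Real.exp_log hD]
  have h2 : (-((N : ℂ) / 2 * h)).re = -(N / 2 * h.re) := by
    have : ((N : ℂ) / 2) = ((N / 2 : ℝ) : ℂ) := by push_cast; rfl
    rw [this, neg_re, re_ofReal_mul]
  rw [h1, norm_exp, h2, ← Real.exp_nat_mul, ← Real.exp_sub]
  congr 1
  push_cast
  ring

/-- If `logDefect f` is, on `S` and on the circle, within `1 / (2 * N)` of the real part of a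
holomorphic function, then the weighted Dirichlet integral over `S` is dominated by the integral
mean over the circle, with constant of order `1 / N`. -/
lemma lintegral_defectDensity_le_of_near {f h : ℂ → ℂ} {ρ : ℝ} (hρ : 1 < ρ)
    (hf : DifferentiableOn ℂ f (ball 0 ρ)) (hf1 : ∀ z ∈ ball (0 : ℂ) ρ, ‖f z‖ < 1)
    (hh : DifferentiableOn ℂ h (ball 0 ρ)) {S : Set ℂ} (hSm : MeasurableSet S)
    (hS : S ⊆ unitDisc) {N : ℕ} (hN : 0 < N)
    (hnS : ∀ z ∈ S, |logDefect (f z) - (h z).re| ≤ 1 / (2 * N))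
    (hnC : ∀ θ, |logDefect (f (circlePt θ)) - (h (circlePt θ)).re| ≤ 1 / (2 * N)) (j : ℕ) :
    ENNReal.ofReal (2 * N) * ∫⁻ z in S, ENNReal.ofReal (defectDensity f (j + 1) z) ≤
      ENNReal.ofReal (Real.exp 1) * ∫⁻ θ in Ioc 0 (2 * π),
        ENNReal.ofReal (1 / (1 - ‖f (circlePt θ)‖ ^ 2) ^ (j + 1)) := by
  have hN' : (0 : ℝ) < N := by exact_mod_cast hN
  have hexp : ∀ x : ℝ, |x| ≤ 1 / (2 * N) →
      Real.exp (-(1 / 2)) ≤ Real.exp (N * x) ∧ Real.exp (N * x) ≤ Real.exp (1 / 2) := by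
    intro x hx
    have h1 := abs_le.mp hx
    have h2 : (N : ℝ) * (1 / (2 * N)) = 1 / 2 := by field_simp
    constructor <;> refine Real.exp_le_exp.mpr ?_
    · nlinarith [mul_le_mul_of_nonneg_left h1.1 hN'.le]
    · nlinarith [mul_le_mul_of_nonneg_left h1.2 hN'.le]
  have hg : DifferentiableOn ℂ (fun z => cexp (-(N / 2 * h z))) (ball 0 ρ) :=
    ((hh.const_mul _).neg).cexp
  have hmain := lintegral_defectDensity_mul_le hρ hf hf1 hg (N + j)
  have hlow : ENNReal.ofReal (Real.exp (-(1 / 2))) *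
      (ENNReal.ofReal (2 * N) * ∫⁻ z in S, ENNReal.ofReal (defectDensity f (j + 1) z)) ≤
      2 * ∫⁻ z in unitDisc, ENNReal.ofReal (((N + j : ℕ) + 1) *
        (‖cexp (-(N / 2 * h z))‖ ^ 2 * defectDensity f (N + j + 1) z)) := by
    rw [ENNReal.ofReal_mul (by norm_num), ENNReal.ofReal_ofNat, mul_left_comm, mul_assoc,
      ← mul_assoc (ENNReal.ofReal _) (ENNReal.ofReal _),
      ← ENNReal.ofReal_mul (by positivity), ← lintegral_const_mul' _ _ ENNReal.ofReal_ne_top]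
    refine mul_le_mul_right (le_trans ?_ (lintegral_mono_set hS)) _
    refine setLIntegral_mono' hSm fun z hz => ?_
    have hz1 : ‖z‖ < 1 := hS hz
    have hw := hf1 z (by simpa using hz1.trans hρ)
    have hD := one_sub_norm_sq_pos hw
    have hDz := one_sub_norm_sq_pos hz1
    have hd0 : 0 ≤ defectDensity f (j + 1) z := by unfold defectDensity; positivity
    have e : ‖cexp (-(N / 2 * h z))‖ ^ 2 * defectDensity f (N + j + 1) z =
        Real.exp (N * (logDefect (f z) - (h z).re)) * defectDensity f (j + 1) z := by
      rw [← norm_sq_exp_div_defect_pow hw, defectDensity, defectDensity,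
        show N + j + 1 + 2 = N + (j + 1 + 2) by ring, pow_add _ N]
      field_simp
    rw [← ENNReal.ofReal_mul (by positivity), e]
    refine ENNReal.ofReal_le_ofReal ?_
    rw [← mul_assoc]
    refine mul_le_mul_of_nonneg_right ?_ hd0
    refine mul_le_mul ?_ (hexp _ (hnS z hz)).1 (Real.exp_pos _).le (by positivity)
    push_cast
    linarith [(Nat.cast_nonneg j : (0 : ℝ) ≤ j)]
  have hup : ∫⁻ θ in Ioc 0 (2 * π), ENNReal.ofReal (‖cexp (-(N / 2 * h (circlePt θ)))‖ ^ 2 /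
      (1 - ‖f (circlePt θ)‖ ^ 2) ^ (N + j + 1)) ≤
      ENNReal.ofReal (Real.exp (1 / 2)) * ∫⁻ θ in Ioc 0 (2 * π),
        ENNReal.ofReal (1 / (1 - ‖f (circlePt θ)‖ ^ 2) ^ (j + 1)) := by
    rw [← lintegral_const_mul' _ _ ENNReal.ofReal_ne_top]
    refine lintegral_mono fun θ => ?_
    have hw := hf1 (circlePt θ) (by simpa using hρ)
    have hD := one_sub_norm_sq_pos hw
    rw [← ENNReal.ofReal_mul (Real.exp_pos _).le]
    refine ENNReal.ofReal_le_ofReal ?_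
    rw [add_assoc, pow_add, ← div_div, norm_sq_exp_div_defect_pow hw, div_eq_mul_one_div]
    exact mul_le_mul_of_nonneg_right (hexp _ (hnC θ)).2 (by positivity)
  have h3 := mul_le_mul_right (hlow.trans (hmain.trans hup)) (ENNReal.ofReal (Real.exp (1 / 2)))
  rwa [← mul_assoc, ← mul_assoc (ENNReal.ofReal _) (ENNReal.ofReal _),
    ← ENNReal.ofReal_mul (Real.exp_pos _).le, ← ENNReal.ofReal_mul (Real.exp_pos _).le,
    ← Real.exp_add, ← Real.exp_add, add_neg_cancel, Real.exp_zero, ENNReal.ofReal_one, one_mul,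
    add_halves] at h3

lemma exists_defect_bounds {F : ℂ → ℂ} (hF : DifferentiableOn ℂ F unitDisc)
    (hmap : ∀ z ∈ unitDisc, F z ∈ unitDisc) {c : ℝ} (hc : c < 1) (k : ℕ) :
    ∃ B : ℝ, 0 ≤ B ∧ ∀ z : ℂ, ‖z‖ ≤ c →
      1 / (1 - ‖F z‖ ^ 2) ^ k ≤ B ∧ ‖deriv F z‖ ^ 2 / (1 - ‖F z‖ ^ 2) ^ (k + 2) ≤ B := by
  have hsub : closedBall (0 : ℂ) c ⊆ unitDisc := fun z hz =>
    (mem_closedBall_zero_iff.mp hz).trans_lt hc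
  have ho : IsOpen unitDisc := by rw [unitDisc_eq_ball]; exact isOpen_ball
  have hFc := hF.continuousOn.mono hsub
  have hFd := (hF.deriv ho).continuousOn.mono hsub
  have hD : ∀ z ∈ closedBall (0 : ℂ) c, 0 < 1 - ‖F z‖ ^ 2 := fun z hz =>
    one_sub_norm_sq_pos (hmap z (hsub hz))
  have hDc : ContinuousOn (fun z => 1 - ‖F z‖ ^ 2) (closedBall 0 c) :=
    continuousOn_const.sub (hFc.norm.pow 2)
  have h1 : ContinuousOn (fun z => 1 / (1 - ‖F z‖ ^ 2) ^ k) (closedBall 0 c) :=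
    continuousOn_const.div (hDc.pow k) fun z hz => (pow_pos (hD z hz) _).ne'
  have h2 : ContinuousOn (fun z => ‖deriv F z‖ ^ 2 / (1 - ‖F z‖ ^ 2) ^ (k + 2)) (closedBall 0 c) :=
    (hFd.norm.pow 2).div (hDc.pow _) fun z hz => (pow_pos (hD z hz) _).ne'
  obtain ⟨B₁, hB₁⟩ := (isCompact_closedBall (0 : ℂ) c).exists_bound_of_continuousOn h1
  obtain ⟨B₂, hB₂⟩ := (isCompact_closedBall (0 : ℂ) c).exists_bound_of_continuousOn h2
  refine ⟨max 0 (max B₁ B₂), le_max_left _ _, fun z hz => ?_⟩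
  have hz' := mem_closedBall_zero_iff.mpr hz
  exact ⟨((le_abs_self _).trans (hB₁ z hz')).trans ((le_max_left _ _).trans (le_max_right _ _)),
    ((le_abs_self _).trans (hB₂ z hz')).trans ((le_max_right _ _).trans (le_max_right _ _))⟩

lemma lintegral_circle_le_of_le {φ : ℝ → ℝ} {B : ℝ} (h : ∀ θ, φ θ ≤ B) :
    ∫⁻ θ in Ioc 0 (2 * π), ENNReal.ofReal (φ θ) ≤ ENNReal.ofReal (2 * π * B) := by
  refine (lintegral_mono fun θ => ENNReal.ofReal_le_ofReal (h θ)).trans (le_of_eq ?_)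
  rw [setLIntegral_const, Real.volume_Ioc, sub_zero, mul_comm,
    ENNReal.ofReal_mul (p := 2 * π) (by positivity)]

lemma ennreal_le_two_mul_of_le_add {I A Y : ℝ≥0∞} (hI : I ≠ ∞) (h : I ≤ A + Y) (hY : 2 * Y ≤ I) :
    I ≤ 2 * A := by
  have h1 : I + I ≤ 2 * A + I := by
    calc I + I = 2 * I := (two_mul I).symm
      _ ≤ 2 * (A + Y) := mul_le_mul_right h 2
      _ = 2 * A + 2 * Y := mul_add _ _ _
      _ ≤ _ := by gcongr
  exact (ENNReal.add_le_add_iff_right hI).mp h1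

lemma exists_lintegral_defect_pow_le {F : ℂ → ℂ} (hF : DifferentiableOn ℂ F unitDisc)
    (hmap : ∀ z ∈ unitDisc, F z ∈ unitDisc)
    (hcar : IsVanishingCarleson ((volume.restrict unitDisc).withDensity (hypDensity F))) (j : ℕ) :
    ∃ M : ℝ, ∀ r : ℝ, 0 < r → r < 1 → ∫⁻ θ in Ioc 0 (2 * π),
      ENNReal.ofReal (1 / (1 - ‖F (r * circlePt θ)‖ ^ 2) ^ (j + 1)) ≤ ENNReal.ofReal M := by
  have hms : MeasurableSet unitDisc := by rw [unitDisc_eq_ball]; exact measurableSet_ball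
  set K : ℝ := 4 * ((j + 1) * (j + 2)) with hK
  have hK0 : 0 < K := by positivity
  obtain ⟨N, hNK⟩ := exists_nat_ge (Real.exp 1 * K)
  have hN0 : (0 : ℝ) < N := (by positivity : 0 < Real.exp 1 * K).trans_le hNK
  have hN : 0 < N := by exact_mod_cast hN0
  obtain ⟨δ, hδ0, hδ1, hδ⟩ := exists_radialOsc_le_of_vanishing hF hmap hcar
    (ε := 2 * π * (1 / (2 * N))) (by positivity)
  obtain ⟨B, hB0, hB⟩ := exists_defect_bounds hF hmap (c := 1 - δ) (by linarith) (j + 1)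
  refine ⟨2 * (2 * π * B + K * (B * π)), fun r hr0 hr1 => ?_⟩
  rcases le_or_gt r (1 - δ) with hrδ | hrδ
  · refine (lintegral_circle_le_of_le fun θ => (hB (r * circlePt θ) ?_).1).trans
      (ENNReal.ofReal_le_ofReal ?_)
    · simpa [abs_of_pos hr0] using hrδ
    · have : 0 ≤ 2 * π * B := by positivity
      have : 0 ≤ K * (B * π) := by positivity
      linarith
  set R : ℝ := √r with hRdef
  have hR0 : 0 < R := Real.sqrt_pos.mpr hr0
  have hRR : R * R = r := Real.mul_self_sqrt hr0.le
  have hR1 : R < 1 := by nlinarith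
  have hρ : 1 < 1 / R := by rw [lt_div_iff₀ hR0]; linarith
  have hmem : ∀ z ∈ ball (0 : ℂ) (1 / R), ‖(R : ℂ) * z‖ < 1 := fun z hz => by
    have h := mem_ball_zero_iff.mp hz
    rw [lt_div_iff₀ hR0] at h
    rwa [norm_mul, norm_real, Real.norm_of_nonneg hR0.le, mul_comm]
  have hmem2 : ∀ z ∈ ball (0 : ℂ) (1 / R), (R : ℂ) * (R * z) ∈ unitDisc := fun z hz =>
    norm_ofReal_mul_lt_one hR0 hR1 (hmem z hz).le
  set f : ℂ → ℂ := fun z => F (R * (R * z)) with hf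
  have hrf : ∀ θ, F (r * circlePt θ) = f (circlePt θ) := fun θ => by
    rw [hf, ← hRR, ofReal_mul, mul_assoc]
  have hfd : DifferentiableOn ℂ f (ball 0 (1 / R)) :=
    hF.comp (by fun_prop) hmem2
  have hf1 : ∀ z ∈ ball (0 : ℂ) (1 / R), ‖f z‖ < 1 := fun z hz => hmap _ (hmem2 z hz)
  set h : ℂ → ℂ := fun z => herglotzExtension (fun ζ => logDefect (F (R * ζ))) (R * z) with hh
  have hhd : DifferentiableOn ℂ h (ball 0 (1 / R)) :=
    (differentiableOn_herglotzExtension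
      (continuous_logDefect_comp_mul_circlePt hF hmap hR0 hR1)).comp (by fun_prop) fun z hz => by
        simpa using hmem z hz
  have hnear : ∀ z ∈ ball (0 : ℂ) (1 / R), 1 - δ ≤ R * ‖(R : ℂ) * z‖ →
      |logDefect (f z) - (h z).re| ≤ 1 / (2 * N) := fun z hz hz' =>
    abs_logDefect_sub_re_herglotzExtension_le hF hmap hR0 hR1 (hmem z hz) (by positivity)
      (hδ R _ hR0 hR1 (hmem z hz) hz')
  have hcb : ∀ θ, circlePt θ ∈ ball (0 : ℂ) (1 / R) := fun θ => by
    rw [mem_ball_zero_iff, norm_circlePt]; exact hρ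
  set T : Set ℂ := {z | 1 - δ ≤ R * ‖(R : ℂ) * z‖} with hT
  have hTm : MeasurableSet T := measurableSet_le (by fun_prop) (by fun_prop)
  have hdisc : ∀ z ∈ unitDisc, z ∈ ball (0 : ℂ) (1 / R) := fun z hz =>
    mem_ball_zero_iff.mpr (lt_trans hz hρ)
  simp_rw [hrf]
  set J := ∫⁻ θ in Ioc 0 (2 * π), ENNReal.ofReal (1 / (1 - ‖f (circlePt θ)‖ ^ 2) ^ (j + 1)) with hJ
  have hout : ENNReal.ofReal (2 * N) *
      ∫⁻ z in unitDisc ∩ T, ENNReal.ofReal (defectDensity f (j + 1) z) ≤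
      ENNReal.ofReal (Real.exp 1) * J := by
    refine lintegral_defectDensity_le_of_near hρ hfd hf1 hhd (hms.inter hTm) inter_subset_left hN
      (fun z hz => hnear z (hdisc z hz.1) hz.2) (fun θ => hnear _ (hcb θ) ?_) j
    rw [norm_mul, norm_circlePt, norm_real, Real.norm_of_nonneg hR0.le, mul_one, hRR]
    exact hrδ.le
  have hin : ∫⁻ z in unitDisc \ T, ENNReal.ofReal (defectDensity f (j + 1) z) ≤
      ENNReal.ofReal (B * π) := by
    calc _ ≤ ∫⁻ z in unitDisc \ T, ENNReal.ofReal B := by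
          refine setLIntegral_mono' (hms.diff hTm) fun z hz => ENNReal.ofReal_le_ofReal ?_
          have hz1 : ‖z‖ < 1 := hz.1
          have hzT : ‖(R : ℂ) * (R * z)‖ ≤ 1 - δ := by
            rw [norm_mul, norm_real, Real.norm_of_nonneg hR0.le]
            exact (not_le.mp hz.2).le
          have hzb := hdisc z hz.1
          have hD := one_sub_norm_sq_pos (hf1 z hzb)
          have hDz := one_sub_norm_sq_pos hz1
          have hder : deriv f z = deriv F (R * (R * z)) * (R * R) := by
            have hg : HasDerivAt (fun w : ℂ => (R : ℂ) * (R * w)) (R * R) z := by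
              simpa using ((hasDerivAt_id z).const_mul (R : ℂ)).const_mul (R : ℂ)
            have hFd : DifferentiableAt ℂ F (R * (R * z)) := hF.differentiableAt
              ((by rw [unitDisc_eq_ball]; exact isOpen_ball : IsOpen unitDisc).mem_nhds
                (hmem2 z hzb))
            exact (hFd.hasDerivAt.comp z hg).deriv
          have hdn : ‖deriv f z‖ ≤ ‖deriv F (R * (R * z))‖ := by
            rw [hder, norm_mul]
            refine mul_le_of_le_one_right (norm_nonneg _) ?_
            rw [norm_mul, norm_real, Real.norm_of_nonneg hR0.le, hRR]
            exact hr1.le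
          refine le_trans ?_ (hB _ hzT).2
          change ‖deriv f z‖ ^ 2 * (1 - ‖z‖ ^ 2) / (1 - ‖f z‖ ^ 2) ^ (j + 1 + 2) ≤
            ‖deriv F (R * (R * z))‖ ^ 2 / (1 - ‖f z‖ ^ 2) ^ (j + 1 + 2)
          refine div_le_div_of_nonneg_right ?_ (by positivity)
          refine (mul_le_of_le_one_right (by positivity) (by nlinarith [sq_nonneg ‖z‖])).trans ?_
          gcongr
      _ ≤ ENNReal.ofReal B * volume unitDisc := by
          rw [setLIntegral_const]
          gcongr
          exact sdiff_subset
      _ = _ := by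
          rw [unitDisc_eq_ball, Complex.volume_ball, ENNReal.ofReal_mul hB0]
          simp [← NNReal.coe_real_pi, ENNReal.ofReal_coe_nnreal]
  have hJtop : J ≠ ∞ := by
    have hc : Continuous fun θ => 1 / (1 - ‖f (circlePt θ)‖ ^ 2) ^ (j + 1) :=
      continuous_const.div ((continuous_const.sub
        ((continuous_comp_circlePt hρ hfd.continuousOn).norm.pow 2)).pow _) fun θ =>
        (pow_pos (one_sub_norm_sq_pos (hf1 _ (hcb θ))) _).ne'
    exact ((hc.integrableOn_Icc.mono_set Ioc_subset_Icc_self).lintegral_lt_top).ne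
  have hJle := lintegral_defect_pow_le hρ hfd hf1 j
  rw [← lintegral_inter_add_sdiff _ unitDisc hTm, mul_add, add_comm (_ * _), ← add_assoc] at hJle
  refine (ennreal_le_two_mul_of_le_add hJtop hJle ?_).trans ?_
  · have h1 : ENNReal.ofReal (Real.exp 1) * (2 * (ENNReal.ofReal K *
        ∫⁻ z in unitDisc ∩ T, ENNReal.ofReal (defectDensity f (j + 1) z))) ≤
        ENNReal.ofReal (Real.exp 1) * J := by
      refine le_trans ?_ hout
      rw [← mul_assoc, ← mul_assoc, ← ENNReal.ofReal_ofNat 2, ← ENNReal.ofReal_mul (by positivity),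
        ← ENNReal.ofReal_mul (by positivity)]
      exact mul_le_mul_left (ENNReal.ofReal_le_ofReal (by linarith)) _
    exact (ENNReal.mul_le_mul_iff_right (by simpa using Real.exp_pos 1)
      ENNReal.ofReal_ne_top).mp h1
  · have hf0 : 1 / (1 - ‖f 0‖ ^ 2) ^ (j + 1) ≤ B := by
      have := (hB 0 (by simpa using hδ1.le)).1
      simpa [hf] using this
    rw [ENNReal.ofReal_mul (p := 2) (by norm_num), ENNReal.ofReal_ofNat,
      ENNReal.ofReal_add (by positivity) (by positivity), ENNReal.ofReal_mul hK0.le]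
    gcongr

lemma rpow_neg_le_two_pow_div {x s : ℝ} (hx0 : 0 ≤ x) (hx : x < 1) {j : ℕ} (hs : s ≤ j) :
    (1 - x) ^ (-s) ≤ 2 ^ j * (1 / (1 - x ^ 2) ^ j) := by
  have h1 : 0 < 1 - x := by linarith
  have h2 : 0 < 1 - x ^ 2 := by nlinarith
  calc (1 - x) ^ (-s) ≤ (1 - x) ^ (-(j : ℝ)) :=
        Real.rpow_le_rpow_of_exponent_ge h1 (by linarith) (by linarith)
    _ = ((1 - x) ^ j)⁻¹ := by rw [Real.rpow_neg h1.le, Real.rpow_natCast]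
    _ ≤ 2 ^ j * (1 / (1 - x ^ 2) ^ j) := by
        rw [← div_eq_mul_one_div, ← div_pow, ← inv_pow]
        refine pow_le_pow_left₀ (by positivity) ?_ _
        rw [inv_eq_one_div, div_le_div_iff₀ h1 h2]
        nlinarith

lemma exists_lintegral_rpow_neg_le {F : ℂ → ℂ} (hF : DifferentiableOn ℂ F unitDisc)
    (hmap : ∀ z ∈ unitDisc, F z ∈ unitDisc)
    (hcar : IsVanishingCarleson ((volume.restrict unitDisc).withDensity (hypDensity F))) (s : ℝ) :
    ∃ M : ℝ, ∀ r : ℝ, 0 < r → r < 1 → ∫⁻ θ in Ioc 0 (2 * π),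
      ENNReal.ofReal ((1 - ‖F (r * circlePt θ)‖) ^ (-s)) ≤ ENNReal.ofReal M := by
  obtain ⟨j, hj⟩ := exists_nat_ge s
  obtain ⟨M, hM⟩ := exists_lintegral_defect_pow_le hF hmap hcar j
  refine ⟨2 ^ (j + 1) * M, fun r hr0 hr1 => ?_⟩
  rw [ENNReal.ofReal_mul (by positivity)]
  refine le_trans ?_ (mul_le_mul_right (hM r hr0 hr1) _)
  rw [← lintegral_const_mul' _ _ ENNReal.ofReal_ne_top]
  refine lintegral_mono fun θ => ?_
  rw [← ENNReal.ofReal_mul (by positivity)]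
  refine ENNReal.ofReal_le_ofReal (rpow_neg_le_two_pow_div (norm_nonneg _)
    (hmap _ (norm_ofReal_mul_lt_one hr0 hr1 (norm_circlePt θ).le)) ?_)
  push_cast
  linarith

end ExponentialMeans

/-- Lemma 2.5(b): if `F` is an analytic self-map of the disc and
`|F'(z)|²(1-|z|²)/(1-|F(z)|²)² dA(z)` is a vanishing Carleson measure, then the
boundary function `log(1-|F|²)` belongs to VMO, and consequently for every
`0 < s < ∞`, `sup_{0<r<1} ∫_{∂𝔻} (1-|F(rξ)|)^{-s} dm(ξ) < ∞`. -/
theorem stmt_10 (F : ℂ → ℂ) (hF : DifferentiableOn ℂ F unitDisc)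
    (hmap : ∀ z ∈ unitDisc, F z ∈ unitDisc)
    (hcar : IsVanishingCarleson
      ((volume.restrict unitDisc).withDensity (hypDensity F))) :
    (∃ Fb : ℝ → ℂ, HasRadialLimits F Fb ∧
      (∀ᵐ θ ∂(volume.restrict (Set.Ioc 0 (2 * Real.pi))), ‖Fb θ‖ < 1) ∧
      IsVMO (fun θ => ((Real.log (1 - ‖Fb θ‖ ^ 2) : ℝ) : ℂ))) ∧
    ∀ s : ℝ, 0 < s → ∃ M : ℝ, ∀ r : ℝ, 0 < r → r < 1 →
      (∫⁻ θ in Set.Ioc 0 (2 * Real.pi),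
        ENNReal.ofReal ((1 - ‖F ((r : ℂ) * circlePt θ)‖) ^ (-s))) ≤
        ENNReal.ofReal M := by
  refine ⟨⟨radialLimit F, ae_restrict_of_ae (ae_tendsto_radialLimit hF hmap), ?_⟩, ?_⟩
  · exact isVMO_log_radialLimit hF hmap hcar
  · exact fun s _ => exists_lintegral_rpow_neg_le hF hmap hcar s
end
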